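/- arXiv:math/0605086 — 8 statements merged into one kernel-verified Lean document; each statement's English description precedes it below -/
import Mathlib

section
/- Let D be an associative unital algebra over a field k and let T : D ⊗ D → D ⊗ D be a twistor for D. Then μ ∘ T : D ⊗ D → D is an associative multiplication on the vector space D with the same unit 1; that is, D^T is an associative unital k-algebra. -/
open TensorProduct

noncomputable section

/-- `T₁₂ = T ⊗ id` on `(D ⊗ D) ⊗ D`. -/
def tensor12 (k : Type*) [Field k] (D : Type*) [AddCommGroup D] [Module k D]
    (T : D ⊗[k] D →ₗ[k] D ⊗[k] D) :
    (D ⊗[k] D) ⊗[k] D →ₗ[k] (D ⊗[k] D) ⊗[k] D :=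
  T.rTensor D

/-- `T₂₃ = id ⊗ T` on `(D ⊗ D) ⊗ D`. -/
def tensor23 (k : Type*) [Field k] (D : Type*) [AddCommGroup D] [Module k D]
    (T : D ⊗[k] D →ₗ[k] D ⊗[k] D) :
    (D ⊗[k] D) ⊗[k] D →ₗ[k] (D ⊗[k] D) ⊗[k] D :=
  (TensorProduct.assoc k D D D).symm.toLinearMap ∘ₗ T.lTensor D ∘ₗ
    (TensorProduct.assoc k D D D).toLinearMap

/-- the flip `id ⊗ τ` of the last two tensor factors of `(D ⊗ D) ⊗ D`. -/
def flip23 (k : Type*) [Field k] (D : Type*) [AddCommGroup D] [Module k D] :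
    (D ⊗[k] D) ⊗[k] D →ₗ[k] (D ⊗[k] D) ⊗[k] D :=
  (TensorProduct.assoc k D D D).symm.toLinearMap ∘ₗ
    ((TensorProduct.comm k D D).toLinearMap.lTensor D) ∘ₗ
    (TensorProduct.assoc k D D D).toLinearMap

/-- `T₁₃ = (id ⊗ τ) ∘ (T ⊗ id) ∘ (id ⊗ τ)` on `(D ⊗ D) ⊗ D`. -/
def tensor13 (k : Type*) [Field k] (D : Type*) [AddCommGroup D] [Module k D]
    (T : D ⊗[k] D →ₗ[k] D ⊗[k] D) :
    (D ⊗[k] D) ⊗[k] D →ₗ[k] (D ⊗[k] D) ⊗[k] D :=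
  flip23 k D ∘ₗ tensor12 k D T ∘ₗ flip23 k D

/-- `μ₁₂ = μ ⊗ id` on `(D ⊗ D) ⊗ D`, for a multiplication `m`. -/
def mul12 (k : Type*) [Field k] (D : Type*) [AddCommGroup D] [Module k D]
    (m : D ⊗[k] D →ₗ[k] D) :
    (D ⊗[k] D) ⊗[k] D →ₗ[k] D ⊗[k] D :=
  m.rTensor D

/-- `μ₂₃ = id ⊗ μ` on `(D ⊗ D) ⊗ D`, for a multiplication `m`. -/
def mul23 (k : Type*) [Field k] (D : Type*) [AddCommGroup D] [Module k D]
    (m : D ⊗[k] D →ₗ[k] D) :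
    (D ⊗[k] D) ⊗[k] D →ₗ[k] D ⊗[k] D :=
  m.lTensor D ∘ₗ (TensorProduct.assoc k D D D).toLinearMap

/-- A twistor for a (possibly deformed) multiplication `m` with unit `e`:
`T(e ⊗ d) = e ⊗ d`, `T(d ⊗ e) = d ⊗ e`,
`μ₂₃ ∘ T₁₃ ∘ T₁₂ = T ∘ μ₂₃`, `μ₁₂ ∘ T₁₃ ∘ T₂₃ = T ∘ μ₁₂`, `T₁₂ ∘ T₂₃ = T₂₃ ∘ T₁₂`. -/
structure IsTwistor (k : Type*) [Field k] (D : Type*) [AddCommGroup D] [Module k D]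
    (m : D ⊗[k] D →ₗ[k] D) (e : D) (T : D ⊗[k] D →ₗ[k] D ⊗[k] D) : Prop where
  one_left : ∀ d : D, T (e ⊗ₜ[k] d) = e ⊗ₜ[k] d
  one_right : ∀ d : D, T (d ⊗ₜ[k] e) = d ⊗ₜ[k] e
  mul_right : mul23 k D m ∘ₗ tensor13 k D T ∘ₗ tensor12 k D T = T ∘ₗ mul23 k D m
  mul_left : mul12 k D m ∘ₗ tensor13 k D T ∘ₗ tensor23 k D T = T ∘ₗ mul12 k D m
  comm1223 : tensor12 k D T ∘ₗ tensor23 k D T = tensor23 k D T ∘ₗ tensor12 k D T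

/-- Theorem 3.3: if `T` is a twistor for an algebra `D`, then `μ ∘ T` is an associative
multiplication on `D` with the same unit `1`. -/
theorem twistor_gives_algebra (k : Type*) [Field k] (D : Type*) [Ring D] [Algebra k D]
    (T : D ⊗[k] D →ₗ[k] D ⊗[k] D)
    (hT : IsTwistor k D (LinearMap.mul' k D) 1 T) :
    (∀ d : D, (LinearMap.mul' k D ∘ₗ T) ((1 : D) ⊗ₜ[k] d) = d) ∧
    (∀ d : D, (LinearMap.mul' k D ∘ₗ T) (d ⊗ₜ[k] (1 : D)) = d) ∧
    (LinearMap.mul' k D ∘ₗ T) ∘ₗ (LinearMap.mul' k D ∘ₗ T).rTensor D =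
      ((LinearMap.mul' k D ∘ₗ T) ∘ₗ (LinearMap.mul' k D ∘ₗ T).lTensor D) ∘ₗ
        (TensorProduct.assoc k D D D).toLinearMap := by
  have h1 : (LinearMap.mul' k D ∘ₗ T).rTensor D =
      mul12 k D (LinearMap.mul' k D) ∘ₗ tensor12 k D T := by
    simp only [mul12, tensor12, LinearMap.rTensor_comp]
  have h2 : (LinearMap.mul' k D ∘ₗ T).lTensor D ∘ₗ (TensorProduct.assoc k D D D).toLinearMap =
      mul23 k D (LinearMap.mul' k D) ∘ₗ tensor23 k D T := by
    apply LinearMap.ext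
    intro x
    simp [mul23, tensor23, LinearMap.lTensor_comp]
  have h3 : LinearMap.mul' k D ∘ₗ mul12 k D (LinearMap.mul' k D) =
      LinearMap.mul' k D ∘ₗ mul23 k D (LinearMap.mul' k D) := by
    apply TensorProduct.ext_threefold
    intro a b c
    simp [mul12, mul23, mul_assoc]
  refine ⟨fun d => by simp [hT.one_left], fun d => by simp [hT.one_right], ?_⟩
  apply LinearMap.ext
  intro x
  have e1 := LinearMap.congr_fun h1 x
  have e2 := LinearMap.congr_fun h2 x
  have l := LinearMap.congr_fun hT.mul_left (tensor12 k D T x)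
  have r := LinearMap.congr_fun hT.mul_right (tensor23 k D T x)
  have c := LinearMap.congr_fun hT.comm1223 x
  have a := LinearMap.congr_fun h3 (tensor13 k D T (tensor23 k D T (tensor12 k D T x)))
  simp only [LinearMap.comp_apply] at e1 e2 l r c a ⊢
  rw [e1, e2, ← l, ← r, c, a]
end
end

section
/- Let A and B be associative unital algebras over a field k and let R : B ⊗ A → A ⊗ B be a twisting map. Define T : (A ⊗ B) ⊗ (A ⊗ B) → (A ⊗ B) ⊗ (A ⊗ B) by T = (id_A ⊗ τ ⊗ id_B) ∘ (id_A ⊗ R ⊗ id_B), where τ : B ⊗ A → A ⊗ B is the flip, i.e. T((a ⊗ b) ⊗ (a' ⊗ b')) = (a ⊗ b_R) ⊗ (a'_R ⊗ b') in the notation R(b ⊗ a) = a_R ⊗ b_R. Then T is a twistor for the ordinary tensor product algebra A ⊗ B, and μ_{A⊗B} ∘ T equals the twisted multiplication μ_R; in particular, the twisted tensor product A ⊗_R B is an associative unital algebra with unit 1 ⊗ 1, and (A ⊗ B)^T = A ⊗_R B. -/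
open TensorProduct

noncomputable section

/-- A twisting map `R : B ⊗ A → A ⊗ B` between algebras `A` and `B`:
`R(b ⊗ 1) = 1 ⊗ b`, `R(1 ⊗ a) = a ⊗ 1`,
`R ∘ (id_B ⊗ μ_A) = (μ_A ⊗ id_B) ∘ (id_A ⊗ R) ∘ (R ⊗ id_A)` and
`R ∘ (μ_B ⊗ id_A) = (id_A ⊗ μ_B) ∘ (R ⊗ id_B) ∘ (id_B ⊗ R)`. -/
structure IsTwistingMap (k : Type*) [Field k] (A : Type*) [Ring A] [Algebra k A]
    (B : Type*) [Ring B] [Algebra k B] (R : B ⊗[k] A →ₗ[k] A ⊗[k] B) : Prop where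
  unit_B : ∀ b : B, R (b ⊗ₜ[k] (1 : A)) = (1 : A) ⊗ₜ[k] b
  unit_A : ∀ a : A, R ((1 : B) ⊗ₜ[k] a) = a ⊗ₜ[k] (1 : B)
  mul_A : R ∘ₗ (LinearMap.mul' k A).lTensor B ∘ₗ (TensorProduct.assoc k B A A).toLinearMap =
      (LinearMap.mul' k A).rTensor B ∘ₗ (TensorProduct.assoc k A A B).symm.toLinearMap ∘ₗ
        R.lTensor A ∘ₗ (TensorProduct.assoc k A B A).toLinearMap ∘ₗ R.rTensor A
  mul_B : R ∘ₗ (LinearMap.mul' k B).rTensor A ∘ₗ (TensorProduct.assoc k B B A).symm.toLinearMap =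
      (LinearMap.mul' k B).lTensor A ∘ₗ (TensorProduct.assoc k A B B).toLinearMap ∘ₗ
        R.rTensor B ∘ₗ (TensorProduct.assoc k B A B).symm.toLinearMap ∘ₗ R.lTensor B

/-- the map `T = (id_A ⊗ τ ⊗ id_B) ∘ (id_A ⊗ R ⊗ id_B)` on `(A ⊗ B) ⊗ (A ⊗ B)`,
sending `(a ⊗ b) ⊗ (a' ⊗ b')` to `(a ⊗ b_R) ⊗ (a'_R ⊗ b')`. -/
def twistT (k : Type*) [Field k] (A : Type*) [Ring A] [Algebra k A]
    (B : Type*) [Ring B] [Algebra k B] (R : B ⊗[k] A →ₗ[k] A ⊗[k] B) :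
    (A ⊗[k] B) ⊗[k] (A ⊗[k] B) →ₗ[k] (A ⊗[k] B) ⊗[k] (A ⊗[k] B) :=
  (TensorProduct.assoc k A B (A ⊗[k] B)).symm.toLinearMap ∘ₗ
    (((TensorProduct.assoc k B A B).toLinearMap ∘ₗ
      (((TensorProduct.comm k A B).toLinearMap ∘ₗ R).rTensor B) ∘ₗ
      (TensorProduct.assoc k B A B).symm.toLinearMap).lTensor A) ∘ₗ
    (TensorProduct.assoc k A B (A ⊗[k] B)).toLinearMap

/-- the multiplication `μ_R = (μ_A ⊗ μ_B) ∘ (id_A ⊗ R ⊗ id_B)` of the twisted tensor product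
`A ⊗_R B`, sending `(a ⊗ b) ⊗ (a' ⊗ b')` to `a a'_R ⊗ b_R b'`. -/
def muR (k : Type*) [Field k] (A : Type*) [Ring A] [Algebra k A]
    (B : Type*) [Ring B] [Algebra k B] (R : B ⊗[k] A →ₗ[k] A ⊗[k] B) :
    (A ⊗[k] B) ⊗[k] (A ⊗[k] B) →ₗ[k] A ⊗[k] B :=
  TensorProduct.map (LinearMap.mul' k A) (LinearMap.mul' k B) ∘ₗ
    (TensorProduct.assoc k A A (B ⊗[k] B)).symm.toLinearMap ∘ₗ
    (((TensorProduct.assoc k A B B).toLinearMap ∘ₗ R.rTensor B ∘ₗ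
      (TensorProduct.assoc k B A B).symm.toLinearMap).lTensor A) ∘ₗ
    (TensorProduct.assoc k A B (A ⊗[k] B)).toLinearMap

theorem twistAux_sum {k : Type*} [Field k] {A : Type*} [Ring A] [Algebra k A]
    {B : Type*} [Ring B] [Algebra k B] (R : B ⊗[k] A →ₗ[k] A ⊗[k] B) :
    ∃ S : B → A → Finset (A × B), ∀ b a, R (b ⊗ₜ[k] a) = ∑ p ∈ S b a, p.1 ⊗ₜ[k] p.2 := by
  have h : ∀ b a, ∃ s : Finset (A × B), R (b ⊗ₜ[k] a) = ∑ p ∈ s, p.1 ⊗ₜ[k] p.2 :=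
    fun b a => TensorProduct.exists_finset _
  choose S hS using h
  exact ⟨S, hS⟩

theorem twistAux_T {k : Type*} [Field k] {A : Type*} [Ring A] [Algebra k A]
    {B : Type*} [Ring B] [Algebra k B] {R : B ⊗[k] A →ₗ[k] A ⊗[k] B}
    {S : B → A → Finset (A × B)}
    (hS : ∀ b a, R (b ⊗ₜ[k] a) = ∑ p ∈ S b a, p.1 ⊗ₜ[k] p.2) (a a' : A) (b b' : B) :
    twistT k A B R ((a ⊗ₜ b) ⊗ₜ (a' ⊗ₜ b')) =
      ∑ p ∈ S b a', (a ⊗ₜ[k] p.2) ⊗ₜ[k] (p.1 ⊗ₜ[k] b') := by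
  simp [twistT, hS, map_sum, TensorProduct.sum_tmul, TensorProduct.tmul_sum]

theorem twistAux_mu {k : Type*} [Field k] {A : Type*} [Ring A] [Algebra k A]
    {B : Type*} [Ring B] [Algebra k B] {R : B ⊗[k] A →ₗ[k] A ⊗[k] B}
    {S : B → A → Finset (A × B)}
    (hS : ∀ b a, R (b ⊗ₜ[k] a) = ∑ p ∈ S b a, p.1 ⊗ₜ[k] p.2) (a a' : A) (b b' : B) :
    muR k A B R ((a ⊗ₜ b) ⊗ₜ (a' ⊗ₜ b')) =
      ∑ p ∈ S b a', (a * p.1) ⊗ₜ[k] (p.2 * b') := by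
  simp [muR, hS, map_sum, TensorProduct.sum_tmul, TensorProduct.tmul_sum]

theorem twistAux_mulA {k : Type*} [Field k] {A : Type*} [Ring A] [Algebra k A]
    {B : Type*} [Ring B] [Algebra k B] {R : B ⊗[k] A →ₗ[k] A ⊗[k] B}
    (hR : IsTwistingMap k A B R) {S : B → A → Finset (A × B)}
    (hS : ∀ b a, R (b ⊗ₜ[k] a) = ∑ p ∈ S b a, p.1 ⊗ₜ[k] p.2)
    {M : Type*} [AddCommGroup M] [Module k M] (f : A ⊗[k] B →ₗ[k] M) (a a' : A) (b : B) :
    ∑ p ∈ S b (a * a'), f (p.1 ⊗ₜ p.2) =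
      ∑ p ∈ S b a, ∑ q ∈ S p.2 a', f ((p.1 * q.1) ⊗ₜ q.2) := by
  have h := congrArg f (LinearMap.congr_fun hR.mul_A ((b ⊗ₜ a) ⊗ₜ a'))
  simpa [hS, map_sum, TensorProduct.sum_tmul, TensorProduct.tmul_sum] using h

theorem twistAux_mulB {k : Type*} [Field k] {A : Type*} [Ring A] [Algebra k A]
    {B : Type*} [Ring B] [Algebra k B] {R : B ⊗[k] A →ₗ[k] A ⊗[k] B}
    (hR : IsTwistingMap k A B R) {S : B → A → Finset (A × B)}
    (hS : ∀ b a, R (b ⊗ₜ[k] a) = ∑ p ∈ S b a, p.1 ⊗ₜ[k] p.2)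
    {M : Type*} [AddCommGroup M] [Module k M] (f : A ⊗[k] B →ₗ[k] M) (a : A) (b b' : B) :
    ∑ p ∈ S (b * b') a, f (p.1 ⊗ₜ p.2) =
      ∑ q ∈ S b' a, ∑ r ∈ S b q.1, f (r.1 ⊗ₜ (r.2 * q.2)) := by
  have h := congrArg f (LinearMap.congr_fun hR.mul_B (b ⊗ₜ (b' ⊗ₜ a)))
  simpa [hS, map_sum, TensorProduct.sum_tmul, TensorProduct.tmul_sum] using h

/-- the linear map `u ⊗ v ↦ (a ⊗ v) ⊗ (u ⊗ b)` -/
def twistAuxPhi (k : Type*) [Field k] {A : Type*} [Ring A] [Algebra k A]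
    {B : Type*} [Ring B] [Algebra k B] (a : A) (b : B) :
    A ⊗[k] B →ₗ[k] (A ⊗[k] B) ⊗[k] (A ⊗[k] B) :=
  TensorProduct.map (TensorProduct.mk k A B a) ((TensorProduct.mk k A B).flip b) ∘ₗ
    (TensorProduct.comm k A B).toLinearMap

/-- the linear map `u ⊗ v ↦ a u ⊗ v b` -/
def twistAuxPsi (k : Type*) [Field k] {A : Type*} [Ring A] [Algebra k A]
    {B : Type*} [Ring B] [Algebra k B] (a : A) (b : B) :
    A ⊗[k] B →ₗ[k] A ⊗[k] B :=
  TensorProduct.map (LinearMap.mulLeft k a) (LinearMap.mulRight k b)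

/-- Section 3: for a twisting map `R`, the map `T = (id ⊗ τ ⊗ id) ∘ (id ⊗ R ⊗ id)` is a
twistor for the tensor product algebra `A ⊗ B`, whose deformed multiplication `μ_{A⊗B} ∘ T`
is `μ_R`; in particular the twisted tensor product `A ⊗_R B` is an associative unital
algebra with unit `1 ⊗ 1`, and `(A ⊗ B)^T = A ⊗_R B`. -/
theorem twistingMap_gives_twistor (k : Type*) [Field k] (A : Type*) [Ring A] [Algebra k A]
    (B : Type*) [Ring B] [Algebra k B] (R : B ⊗[k] A →ₗ[k] A ⊗[k] B)
    (hR : IsTwistingMap k A B R) :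
    IsTwistor k (A ⊗[k] B) (LinearMap.mul' k (A ⊗[k] B)) 1 (twistT k A B R) ∧
    LinearMap.mul' k (A ⊗[k] B) ∘ₗ twistT k A B R = muR k A B R ∧
    (∀ x : A ⊗[k] B, muR k A B R (((1 : A) ⊗ₜ[k] (1 : B)) ⊗ₜ[k] x) = x) ∧
    (∀ x : A ⊗[k] B, muR k A B R (x ⊗ₜ[k] ((1 : A) ⊗ₜ[k] (1 : B))) = x) ∧
    muR k A B R ∘ₗ (muR k A B R).rTensor (A ⊗[k] B) =
      (muR k A B R ∘ₗ (muR k A B R).lTensor (A ⊗[k] B)) ∘ₗ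
        (TensorProduct.assoc k (A ⊗[k] B) (A ⊗[k] B) (A ⊗[k] B)).toLinearMap := by
  obtain ⟨S, hS⟩ := twistAux_sum R
  have hT := twistAux_T hS
  have hmu := twistAux_mu hS
  have h1 : ∀ (a : A) (b : B) (x : A) (y : B),
      twistAuxPhi k a b (x ⊗ₜ y) = (a ⊗ₜ[k] y) ⊗ₜ[k] (x ⊗ₜ[k] b) := by
    intros; simp [twistAuxPhi]
  have h2 : ∀ (a : A) (b : B) (x : A) (y : B),
      twistAuxPsi k a b (x ⊗ₜ y) = (a * x) ⊗ₜ[k] (y * b) := by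
    intros; simp [twistAuxPsi]
  have hTm : LinearMap.mul' k (A ⊗[k] B) ∘ₗ twistT k A B R = muR k A B R := by
    ext a b a' b'
    simp [hT, hmu]
  have u1 : ∀ x : A ⊗[k] B, twistT k A B R ((1 : A ⊗[k] B) ⊗ₜ x) = 1 ⊗ₜ x := by
    intro x
    induction x with
    | zero => simp
    | add x y hx hy => rw [TensorProduct.tmul_add, map_add, hx, hy]
    | tmul a b => simp [twistT, Algebra.TensorProduct.one_def, hR.unit_A]
  have u2 : ∀ x : A ⊗[k] B, twistT k A B R (x ⊗ₜ (1 : A ⊗[k] B)) = x ⊗ₜ 1 := by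
    intro x
    induction x with
    | zero => simp
    | add x y hx hy => rw [TensorProduct.add_tmul, map_add, hx, hy]
    | tmul a b => simp [twistT, Algebra.TensorProduct.one_def, hR.unit_B]
  refine ⟨⟨u1, u2, ?_, ?_, ?_⟩, hTm, ?_, ?_, ?_⟩
  · ext a b a' b' a'' b''
    have := twistAux_mulA hR hS (twistAuxPhi k a (b' * b'')) a' a'' b
    simp only [h1] at this
    simp [mul23, tensor13, tensor12, flip23, hT, map_sum, TensorProduct.sum_tmul,
      TensorProduct.tmul_sum, this]
  · ext a b a' b' a'' b''
    have := twistAux_mulB hR hS (twistAuxPhi k (a * a') b'') a'' b b'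
    simp only [h1] at this
    simp [mul12, tensor13, tensor12, tensor23, flip23, hT, map_sum, TensorProduct.sum_tmul,
      TensorProduct.tmul_sum, this]
  · ext a b a' b' a'' b''
    simp only [tensor12, tensor23, TensorProduct.AlgebraTensorModule.curry_apply,
      LinearMap.restrictScalars_self, TensorProduct.curry_apply, LinearMap.comp_apply,
      LinearEquiv.coe_coe, TensorProduct.assoc_tmul, TensorProduct.assoc_symm_tmul,
      LinearMap.lTensor_tmul, LinearMap.rTensor_tmul, hT, map_sum, TensorProduct.sum_tmul,
      TensorProduct.tmul_sum]
    exact Finset.sum_comm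
  · intro x
    rw [← hTm, ← Algebra.TensorProduct.one_def, LinearMap.comp_apply, u1]
    simp
  · intro x
    rw [← hTm, ← Algebra.TensorProduct.one_def, LinearMap.comp_apply, u2]
    simp
  · ext a b a' b' a'' b''
    have e1 : ∀ p : A × B, ∑ q ∈ S (p.2 * b') a'', (a * p.1 * q.1) ⊗ₜ[k] (q.2 * b'') =
        ∑ q ∈ S b' a'', ∑ r ∈ S p.2 q.1, (a * p.1 * r.1) ⊗ₜ[k] (r.2 * q.2 * b'') := by
      intro p
      have := twistAux_mulB hR hS (twistAuxPsi k (a * p.1) b'') a'' p.2 b'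
      simpa only [h2] using this
    have e2 : ∀ q : A × B, ∑ p ∈ S b (a' * q.1), (a * p.1) ⊗ₜ[k] (p.2 * (q.2 * b'')) =
        ∑ p ∈ S b a', ∑ r ∈ S p.2 q.1, (a * (p.1 * r.1)) ⊗ₜ[k] (r.2 * (q.2 * b'')) := by
      intro q
      have := twistAux_mulA hR hS (twistAuxPsi k a (q.2 * b'')) a' q.1 b
      simpa only [h2] using this
    simp only [TensorProduct.AlgebraTensorModule.curry_apply,
      LinearMap.restrictScalars_self, TensorProduct.curry_apply, LinearMap.comp_apply,
      LinearEquiv.coe_coe, TensorProduct.assoc_tmul,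
      LinearMap.lTensor_tmul, LinearMap.rTensor_tmul, hmu, map_sum, TensorProduct.sum_tmul,
      TensorProduct.tmul_sum, e1, e2]
    rw [Finset.sum_comm]
    simp only [mul_assoc]
end
end

section
/- Let A and B be associative unital algebras over a field k and let R : B ⊗ A → A ⊗ B be a linear map such that the map T = (id_A ⊗ τ ⊗ id_B) ∘ (id_A ⊗ R ⊗ id_B), where τ : B ⊗ A → A ⊗ B is the flip, is a twistor for the ordinary tensor product algebra A ⊗ B. Then R is a twisting map between A and B, and (A ⊗ B)^T = A ⊗_R B. -/
open TensorProduct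

noncomputable section

/-- the linear map `x ⊗ y ↦ (a ⊗ y) ⊗ (x ⊗ b)`. -/
def spread (k : Type*) [Field k] (A : Type*) [Ring A] [Algebra k A]
    (B : Type*) [Ring B] [Algebra k B] (a : A) (b : B) :
    A ⊗[k] B →ₗ[k] (A ⊗[k] B) ⊗[k] (A ⊗[k] B) :=
  TensorProduct.map (TensorProduct.mk k A B a) ((TensorProduct.mk k A B).flip b) ∘ₗ
    (TensorProduct.comm k A B).toLinearMap

theorem spread_tmul (k : Type*) [Field k] (A : Type*) [Ring A] [Algebra k A]
    (B : Type*) [Ring B] [Algebra k B] (a x : A) (b y : B) :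
    spread k A B a b (x ⊗ₜ y) = (a ⊗ₜ y) ⊗ₜ (x ⊗ₜ b) := by
  simp [spread]

theorem twistT_tmul (k : Type*) [Field k] (A : Type*) [Ring A] [Algebra k A]
    (B : Type*) [Ring B] [Algebra k B] (R : B ⊗[k] A →ₗ[k] A ⊗[k] B) (a a' : A) (b b' : B) :
    twistT k A B R ((a ⊗ₜ b) ⊗ₜ (a' ⊗ₜ b')) = spread k A B a b' (R (b ⊗ₜ a')) := by
  simp only [twistT, LinearMap.comp_apply, LinearEquiv.coe_coe, TensorProduct.assoc_tmul,
    LinearMap.lTensor_tmul, TensorProduct.assoc_symm_tmul, LinearMap.rTensor_tmul]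
  induction R (b ⊗ₜ a') with
  | zero => simp
  | tmul x y => simp [spread_tmul]
  | add x y hx hy => simp only [map_add, TensorProduct.add_tmul, TensorProduct.tmul_add, hx, hy]

theorem mul_spread (k : Type*) [Field k] (A : Type*) [Ring A] [Algebra k A]
    (B : Type*) [Ring B] [Algebra k B] (z : A ⊗[k] B) :
    LinearMap.mul' k (A ⊗[k] B) (spread k A B 1 1 z) = z := by
  induction z with
  | zero => simp
  | tmul x y => simp [spread_tmul]
  | add x y hx hy => simp only [map_add, hx, hy]

set_option maxHeartbeats 2000000

/-- Section 3, converse: if `R : B ⊗ A → A ⊗ B` is a linear map such that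
`T = (id ⊗ τ ⊗ id) ∘ (id ⊗ R ⊗ id)` is a twistor for the tensor product algebra `A ⊗ B`,
then `R` is a twisting map and `(A ⊗ B)^T = A ⊗_R B`. -/
theorem twistor_gives_twistingMap (k : Type*) [Field k] (A : Type*) [Ring A] [Algebra k A]
    (B : Type*) [Ring B] [Algebra k B] (R : B ⊗[k] A →ₗ[k] A ⊗[k] B)
    (hT : IsTwistor k (A ⊗[k] B) (LinearMap.mul' k (A ⊗[k] B)) 1 (twistT k A B R)) :
    IsTwistingMap k A B R ∧
    LinearMap.mul' k (A ⊗[k] B) ∘ₗ twistT k A B R = muR k A B R := by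
  have hmul : ∀ (b : B) (a : A), LinearMap.mul' k (A ⊗[k] B)
      (twistT k A B R ((1 ⊗ₜ b) ⊗ₜ (a ⊗ₜ 1))) = R (b ⊗ₜ a) := by
    intro b a
    rw [twistT_tmul, mul_spread]
  refine ⟨⟨?_, ?_, ?_, ?_⟩, ?_⟩
  · intro b
    have h := hT.one_right ((1 : A) ⊗ₜ[k] b)
    rw [Algebra.TensorProduct.one_def] at h
    rw [← hmul, h]
    simp
  · intro a
    have h := hT.one_left (a ⊗ₜ[k] (1 : B))
    rw [Algebra.TensorProduct.one_def] at h
    rw [← hmul, h]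
    simp
  · apply TensorProduct.ext_threefold
    intro b a a'
    have h := congrArg (LinearMap.mul' k (A ⊗[k] B)) (LinearMap.congr_fun hT.mul_right
      ((((1 : A) ⊗ₜ[k] b) ⊗ₜ[k] (a ⊗ₜ[k] (1 : B))) ⊗ₜ[k] (a' ⊗ₜ[k] (1 : B))))
    simp only [mul23, LinearMap.comp_apply, LinearEquiv.coe_coe, TensorProduct.assoc_tmul,
      LinearMap.lTensor_tmul, LinearMap.mul'_apply, Algebra.TensorProduct.tmul_mul_tmul, mul_one,
      hmul, tensor12, LinearMap.rTensor_tmul, twistT_tmul] at h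
    simp only [LinearMap.comp_apply, LinearEquiv.coe_coe, TensorProduct.assoc_tmul,
      LinearMap.lTensor_tmul, LinearMap.mul'_apply, LinearMap.rTensor_tmul]
    rw [mul_spread] at h
    rw [← h]
    clear h
    induction R (b ⊗ₜ a) with
    | zero => simp
    | add x y hx hy => simp only [map_add, TensorProduct.add_tmul, hx, hy]
    | tmul p q =>
      simp only [spread_tmul, tensor13, flip23, tensor12, LinearMap.comp_apply,
        LinearEquiv.coe_coe, TensorProduct.assoc_tmul, LinearMap.lTensor_tmul,
        TensorProduct.comm_tmul, TensorProduct.assoc_symm_tmul, LinearMap.rTensor_tmul,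
        twistT_tmul]
      induction R (q ⊗ₜ a') with
      | zero => simp
      | add x y hx hy => simp only [map_add, TensorProduct.add_tmul, TensorProduct.tmul_add, hx, hy]
      | tmul x y => simp [spread_tmul]
  · rw [← LinearMap.cancel_right (TensorProduct.assoc k B B A).surjective]
    apply TensorProduct.ext_threefold
    intro b b' a
    have h := congrArg (LinearMap.mul' k (A ⊗[k] B)) (LinearMap.congr_fun hT.mul_left
      ((((1 : A) ⊗ₜ[k] b) ⊗ₜ[k] ((1 : A) ⊗ₜ[k] b')) ⊗ₜ[k] (a ⊗ₜ[k] (1 : B))))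
    simp only [mul12, LinearMap.comp_apply, LinearEquiv.coe_coe, TensorProduct.assoc_tmul,
      LinearMap.rTensor_tmul, LinearMap.mul'_apply, Algebra.TensorProduct.tmul_mul_tmul, mul_one,
      hmul, tensor23, LinearMap.lTensor_tmul, twistT_tmul] at h
    simp only [LinearMap.comp_apply, LinearEquiv.coe_coe, TensorProduct.assoc_tmul,
      TensorProduct.assoc_symm_tmul,
      LinearMap.lTensor_tmul, LinearMap.mul'_apply, LinearMap.rTensor_tmul]
    rw [mul_spread] at h
    rw [← h]
    clear h
    induction R (b' ⊗ₜ a) with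
    | zero => simp
    | add x y hx hy => simp only [map_add, TensorProduct.tmul_add, hx, hy]
    | tmul p q =>
      simp only [spread_tmul, tensor13, flip23, tensor12, LinearMap.comp_apply,
        LinearEquiv.coe_coe, TensorProduct.assoc_tmul, LinearMap.lTensor_tmul,
        TensorProduct.comm_tmul, TensorProduct.assoc_symm_tmul, LinearMap.rTensor_tmul,
        twistT_tmul]
      induction R (b ⊗ₜ p) with
      | zero => simp
      | add x y hx hy => simp only [map_add, TensorProduct.add_tmul, TensorProduct.tmul_add, hx, hy]
      | tmul x y => simp [spread_tmul]
  · apply TensorProduct.ext_fourfold'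
    intro a b a' b'
    simp only [LinearMap.comp_apply, twistT_tmul, muR, LinearEquiv.coe_coe,
      TensorProduct.assoc_tmul, LinearMap.lTensor_tmul, TensorProduct.assoc_symm_tmul,
      LinearMap.rTensor_tmul]
    induction R (b ⊗ₜ a') with
    | zero => simp
    | tmul x y => simp [spread_tmul]
    | add x y hx hy => simp only [map_add, TensorProduct.add_tmul, TensorProduct.tmul_add, hx, hy]
end
end

section
/- Let D be an associative unital algebra over a field k and let T be a bijective R-matrix for D satisfying the conditions T₁₂ ∘ T₁₃ = T₁₃ ∘ T₁₂ and T₁₃ ∘ T₂₃ = T₂₃ ∘ T₁₃. Then T is a twistor for D. -/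
open TensorProduct

noncomputable section

/-- An R-matrix (Borcherds) for a multiplication `m` with unit `e`. -/
structure IsRMatrix (k : Type*) [Field k] (D : Type*) [AddCommGroup D] [Module k D]
    (m : D ⊗[k] D →ₗ[k] D) (e : D) (T : D ⊗[k] D →ₗ[k] D ⊗[k] D) : Prop where
  one_left : ∀ d : D, T (e ⊗ₜ[k] d) = e ⊗ₜ[k] d
  one_right : ∀ d : D, T (d ⊗ₜ[k] e) = d ⊗ₜ[k] e
  mul_right : mul23 k D m ∘ₗ tensor12 k D T ∘ₗ tensor13 k D T = T ∘ₗ mul23 k D m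
  mul_left : mul12 k D m ∘ₗ tensor23 k D T ∘ₗ tensor13 k D T = T ∘ₗ mul12 k D m
  qybe : tensor12 k D T ∘ₗ tensor13 k D T ∘ₗ tensor23 k D T =
    tensor23 k D T ∘ₗ tensor13 k D T ∘ₗ tensor12 k D T

/-- Remark 3.5, second part: a bijective R-matrix satisfying the commutation conditions
`T₁₂ ∘ T₁₃ = T₁₃ ∘ T₁₂` and `T₁₃ ∘ T₂₃ = T₂₃ ∘ T₁₃` is a twistor. -/
theorem bijective_rmatrix_isTwistor (k : Type*) [Field k] (D : Type*) [Ring D] [Algebra k D]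
    (T : D ⊗[k] D →ₗ[k] D ⊗[k] D) (hbij : Function.Bijective T)
    (hT : IsRMatrix k D (LinearMap.mul' k D) 1 T)
    (h1213 : tensor12 k D T ∘ₗ tensor13 k D T = tensor13 k D T ∘ₗ tensor12 k D T)
    (h1323 : tensor13 k D T ∘ₗ tensor23 k D T = tensor23 k D T ∘ₗ tensor13 k D T) :
    IsTwistor k D (LinearMap.mul' k D) 1 T := by
  have hflip : Function.Injective (flip23 k D) := by
    unfold flip23
    simp only [LinearMap.coe_comp, LinearEquiv.coe_coe]
    exact (TensorProduct.assoc k D D D).symm.injective.comp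
      ((Module.Flat.lTensor_preserves_injective_linearMap (M := D)
        (TensorProduct.comm k D D).toLinearMap (TensorProduct.comm k D D).injective).comp
        (TensorProduct.assoc k D D D).injective)
  have h12 : Function.Injective (tensor12 k D T) :=
    Module.Flat.rTensor_preserves_injective_linearMap (M := D) T hbij.1
  have h13 : Function.Injective (tensor13 k D T) := by
    unfold tensor13
    simp only [LinearMap.coe_comp]
    exact hflip.comp (h12.comp hflip)
  refine ⟨hT.one_left, hT.one_right, ?_, ?_, ?_⟩
  · rw [← h1213]
    exact hT.mul_right
  · rw [h1323]
    exact hT.mul_left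
  · refine LinearMap.ext fun x => h13 ?_
    have q := LinearMap.congr_fun hT.qybe x
    have a := LinearMap.congr_fun h1213 (tensor23 k D T x)
    have b := LinearMap.congr_fun h1323 (tensor12 k D T x)
    simp only [LinearMap.comp_apply] at q a b ⊢
    rw [← a, q, b]
end
end

section
/- Let A, B, C be associative unital algebras over a field k and let R₁ : B ⊗ A → A ⊗ B, R₂ : C ⊗ B → B ⊗ C, R₃ : C ⊗ A → A ⊗ C be twisting maps, with notation R_i(y ⊗ x) = x_{R_i} ⊗ y_{R_i}. Let D = A ⊗ B ⊗ C with the ordinary tensor product algebra structure and define T : D ⊗ D → D ⊗ D by T((a ⊗ b ⊗ c) ⊗ (a' ⊗ b' ⊗ c')) = (a ⊗ b_{R₁} ⊗ (c_{R₃})_{R₂}) ⊗ ((a'_{R₃})_{R₁} ⊗ b'_{R₂} ⊗ c'). Then T is a twistor for D if and only if for all a ∈ A, b ∈ B, c ∈ C: a_{R₁} ⊗ (b_{R₁})_{R₂} ⊗ c_{R₂} = a_{R₁} ⊗ (b_{R₂})_{R₁} ⊗ c_{R₂}, (a_{R₁})_{R₃} ⊗ b_{R₁} ⊗ c_{R₃}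 = (a_{R₃})_{R₁} ⊗ b_{R₁} ⊗ c_{R₃}, and a_{R₃} ⊗ b_{R₂} ⊗ (c_{R₃})_{R₂} = a_{R₃} ⊗ b_{R₂} ⊗ (c_{R₂})_{R₃} (each tensor written with independent copies of the twisting maps applied as indicated). Moreover, if these conditions hold then R₁, R₂, R₃ are compatible, i.e. (id_A ⊗ R₂) ∘ (R₃ ⊗ id_B) ∘ (id_C ⊗ R₁) = (R₁ ⊗ id_C) ∘ (id_B ⊗ R₃) ∘ (R₂ ⊗ id_A) as maps C ⊗ B ⊗ A → A ⊗ B ⊗ C. -/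
open TensorProduct

noncomputable section

section BigT

variable (k : Type*) [Field k] (A B C : Type*)
  [Ring A] [Algebra k A] [Ring B] [Algebra k B] [Ring C] [Algebra k C]

/-- the map `T` on `D ⊗ D`, `D = (A ⊗ B) ⊗ C`, sending
`((a ⊗ b) ⊗ c) ⊗ ((a' ⊗ b') ⊗ c')` to
`((a ⊗ b_{R₁}) ⊗ (c_{R₃})_{R₂}) ⊗ (((a'_{R₃})_{R₁} ⊗ b'_{R₂}) ⊗ c')`. -/
def bigT (R₁ : B ⊗[k] A →ₗ[k] A ⊗[k] B) (R₂ : C ⊗[k] B →ₗ[k] B ⊗[k] C)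
    (R₃ : C ⊗[k] A →ₗ[k] A ⊗[k] C) :
    ((A ⊗[k] B) ⊗[k] C) ⊗[k] ((A ⊗[k] B) ⊗[k] C) →ₗ[k]
      ((A ⊗[k] B) ⊗[k] C) ⊗[k] ((A ⊗[k] B) ⊗[k] C) :=
  -- step 4d : regroup `A ⊗ (B ⊗ ((C ⊗ (A ⊗ B)) ⊗ C))` back to `((A ⊗ B) ⊗ C) ⊗ ((A ⊗ B) ⊗ C)`
  ((TensorProduct.assoc k (A ⊗[k] B) C ((A ⊗[k] B) ⊗[k] C)).symm.toLinearMap ∘ₗ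
    (TensorProduct.assoc k A B (C ⊗[k] ((A ⊗[k] B) ⊗[k] C))).symm.toLinearMap ∘ₗ
    (TensorProduct.congr (LinearEquiv.refl k A) (TensorProduct.congr (LinearEquiv.refl k B)
      (TensorProduct.assoc k C (A ⊗[k] B) C))).toLinearMap) ∘ₗ
  -- step 4c : apply the flip `τ_{(A⊗B), C}` to the middle `(A ⊗ B) ⊗ C`
  ((((TensorProduct.comm k (A ⊗[k] B) C).toLinearMap.rTensor C).lTensor B).lTensor A) ∘ₗ
  -- step 4b : regroup `A ⊗ ((B ⊗ A) ⊗ ((B ⊗ C) ⊗ C))` to `A ⊗ (B ⊗ (((A ⊗ B) ⊗ C) ⊗ C))`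
  ((TensorProduct.congr (LinearEquiv.refl k A)
    ((TensorProduct.assoc k B A ((B ⊗[k] C) ⊗[k] C)) ≪≫ₗ
      TensorProduct.congr (LinearEquiv.refl k B)
        ((TensorProduct.assoc k A (B ⊗[k] C) C).symm ≪≫ₗ
          TensorProduct.congr (TensorProduct.assoc k A B C).symm
            (LinearEquiv.refl k C)))).toLinearMap) ∘ₗ
  -- step 4a : flip the middle `A ⊗ B` coming from `R₁`
  (((TensorProduct.comm k A B).toLinearMap.rTensor ((B ⊗[k] C) ⊗[k] C)).lTensor A) ∘ₗ
  -- step 3 : apply `R₁` to `(b, a'_{R₃})` and `R₂` to `(c_{R₃}, b')`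
  ((TensorProduct.map R₁ (R₂.rTensor C)).lTensor A) ∘ₗ
  -- step 2 : regroup `A ⊗ (B ⊗ ((A ⊗ C) ⊗ (B ⊗ C)))` to `A ⊗ ((B ⊗ A) ⊗ ((C ⊗ B) ⊗ C))`
  ((TensorProduct.congr (LinearEquiv.refl k A)
    ((TensorProduct.congr (LinearEquiv.refl k B)
      ((TensorProduct.assoc k A C (B ⊗[k] C)) ≪≫ₗ
        TensorProduct.congr (LinearEquiv.refl k A)
          (TensorProduct.assoc k C B C).symm)) ≪≫ₗ
      (TensorProduct.assoc k B A ((C ⊗[k] B) ⊗[k] C)).symm)).toLinearMap) ∘ₗ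
  -- step 1 : apply `R₃` to `(c, a')`
  (((R₃.rTensor (B ⊗[k] C)).lTensor B).lTensor A) ∘ₗ
  -- step 0 : regroup `((A ⊗ B) ⊗ C) ⊗ ((A ⊗ B) ⊗ C)` to `A ⊗ (B ⊗ ((C ⊗ A) ⊗ (B ⊗ C)))`
  (((TensorProduct.assoc k (A ⊗[k] B) C ((A ⊗[k] B) ⊗[k] C)) ≪≫ₗ
    (TensorProduct.assoc k A B (C ⊗[k] ((A ⊗[k] B) ⊗[k] C))) ≪≫ₗ
    TensorProduct.congr (LinearEquiv.refl k A) (TensorProduct.congr (LinearEquiv.refl k B)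
      ((TensorProduct.congr (LinearEquiv.refl k C) (TensorProduct.assoc k A B C)) ≪≫ₗ
        (TensorProduct.assoc k C A (B ⊗[k] C)).symm))).toLinearMap)

end BigT

set_option linter.unusedSimpArgs false

section Helpers

variable {k : Type*} [Field k] {A B C : Type*}
  [Ring A] [Algebra k A] [Ring B] [Algebra k B] [Ring C] [Algebra k C]

/-- A finite Sweedler-type expansion of `R (y ⊗ x)`. -/
def sw {X Y U V : Type*} [AddCommGroup X] [Module k X] [AddCommGroup Y] [Module k Y]
    [AddCommGroup U] [Module k U] [AddCommGroup V] [Module k V]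
    (R : X ⊗[k] Y →ₗ[k] U ⊗[k] V) (x : X) (y : Y) : Finset (U × V) :=
  (TensorProduct.exists_finset (R (x ⊗ₜ[k] y))).choose

theorem sw_spec {X Y U V : Type*} [AddCommGroup X] [Module k X] [AddCommGroup Y] [Module k Y]
    [AddCommGroup U] [Module k U] [AddCommGroup V] [Module k V]
    (R : X ⊗[k] Y →ₗ[k] U ⊗[k] V) (x : X) (y : Y) :
    R (x ⊗ₜ[k] y) = ∑ p ∈ sw R x y, p.1 ⊗ₜ[k] p.2 :=
  (TensorProduct.exists_finset (R (x ⊗ₜ[k] y))).choose_spec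

variable (k A B C) in
/-- `D = (A ⊗ B) ⊗ C`. -/
abbrev DD := (A ⊗[k] B) ⊗[k] C

/-- flip -/
abbrev fl (k : Type*) [Field k] (X Y : Type*) [AddCommGroup X] [Module k X]
    [AddCommGroup Y] [Module k Y] : X ⊗[k] Y →ₗ[k] Y ⊗[k] X :=
  (TensorProduct.comm k X Y).toLinearMap

/-- the part of `T` coming from `R₁` -/
def t1 (R₁ : B ⊗[k] A →ₗ[k] A ⊗[k] B) :
    DD k A B C ⊗[k] DD k A B C →ₗ[k] DD k A B C ⊗[k] DD k A B C :=
  bigT k A B C R₁ (fl k C B) (fl k C A)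

/-- the part of `T` coming from `R₂` -/
def t2 (R₂ : C ⊗[k] B →ₗ[k] B ⊗[k] C) :
    DD k A B C ⊗[k] DD k A B C →ₗ[k] DD k A B C ⊗[k] DD k A B C :=
  bigT k A B C (fl k B A) R₂ (fl k C A)

/-- the part of `T` coming from `R₃` -/
def t3 (R₃ : C ⊗[k] A →ₗ[k] A ⊗[k] C) :
    DD k A B C ⊗[k] DD k A B C →ₗ[k] DD k A B C ⊗[k] DD k A B C :=
  bigT k A B C (fl k B A) (fl k C B) R₃

theorem ext2 {M : Type*} [AddCommMonoid M] [Module k M]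
    {f g : DD k A B C ⊗[k] DD k A B C →ₗ[k] M}
    (h : ∀ (a a' : A) (b b' : B) (c c' : C),
      f (((a ⊗ₜ[k] b) ⊗ₜ[k] c) ⊗ₜ[k] ((a' ⊗ₜ[k] b') ⊗ₜ[k] c')) =
      g (((a ⊗ₜ[k] b) ⊗ₜ[k] c) ⊗ₜ[k] ((a' ⊗ₜ[k] b') ⊗ₜ[k] c'))) : f = g := by
  ext a b c a' b' c'
  exact h a a' b b' c c'

theorem ext3 {M : Type*} [AddCommMonoid M] [Module k M]
    {f g : (DD k A B C ⊗[k] DD k A B C) ⊗[k] DD k A B C →ₗ[k] M}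
    (h : ∀ (a a' a'' : A) (b b' b'' : B) (c c' c'' : C),
      f ((((a ⊗ₜ[k] b) ⊗ₜ[k] c) ⊗ₜ[k] ((a' ⊗ₜ[k] b') ⊗ₜ[k] c')) ⊗ₜ[k] ((a'' ⊗ₜ[k] b'') ⊗ₜ[k] c'')) =
      g ((((a ⊗ₜ[k] b) ⊗ₜ[k] c) ⊗ₜ[k] ((a' ⊗ₜ[k] b') ⊗ₜ[k] c')) ⊗ₜ[k]
        ((a'' ⊗ₜ[k] b'') ⊗ₜ[k] c''))) : f = g := by
  ext a b c a' b' c' a'' b'' c''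
  exact h a a' a'' b b' b'' c c' c''

theorem t1_tmul (R₁ : B ⊗[k] A →ₗ[k] A ⊗[k] B) (a a' : A) (b b' : B) (c c' : C) :
    t1 R₁ (((a ⊗ₜ[k] b) ⊗ₜ[k] c) ⊗ₜ[k] ((a' ⊗ₜ[k] b') ⊗ₜ[k] c')) =
      ∑ p ∈ sw R₁ b a', ((a ⊗ₜ[k] p.2) ⊗ₜ[k] c) ⊗ₜ[k] ((p.1 ⊗ₜ[k] b') ⊗ₜ[k] c') := by
  simp [t1, bigT, sw_spec R₁, TensorProduct.tmul_sum, TensorProduct.sum_tmul]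

theorem t2_tmul (R₂ : C ⊗[k] B →ₗ[k] B ⊗[k] C) (a a' : A) (b b' : B) (c c' : C) :
    t2 R₂ (((a ⊗ₜ[k] b) ⊗ₜ[k] c) ⊗ₜ[k] ((a' ⊗ₜ[k] b') ⊗ₜ[k] c')) =
      ∑ p ∈ sw R₂ c b', ((a ⊗ₜ[k] b) ⊗ₜ[k] p.2) ⊗ₜ[k] ((a' ⊗ₜ[k] p.1) ⊗ₜ[k] c') := by
  simp [t2, bigT, sw_spec R₂, TensorProduct.tmul_sum, TensorProduct.sum_tmul]

theorem t3_tmul (R₃ : C ⊗[k] A →ₗ[k] A ⊗[k] C) (a a' : A) (b b' : B) (c c' : C) :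
    t3 R₃ (((a ⊗ₜ[k] b) ⊗ₜ[k] c) ⊗ₜ[k] ((a' ⊗ₜ[k] b') ⊗ₜ[k] c')) =
      ∑ p ∈ sw R₃ c a', ((a ⊗ₜ[k] b) ⊗ₜ[k] p.2) ⊗ₜ[k] ((p.1 ⊗ₜ[k] b') ⊗ₜ[k] c') := by
  simp [t3, bigT, sw_spec R₃, TensorProduct.tmul_sum, TensorProduct.sum_tmul]

theorem bigT_eq (R₁ : B ⊗[k] A →ₗ[k] A ⊗[k] B) (R₂ : C ⊗[k] B →ₗ[k] B ⊗[k] C)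
    (R₃ : C ⊗[k] A →ₗ[k] A ⊗[k] C) :
    bigT k A B C R₁ R₂ R₃ = t1 R₁ ∘ₗ t2 R₂ ∘ₗ t3 R₃ := by
  apply ext2
  intro a a' b b' c c'
  simp only [LinearMap.comp_apply, t3_tmul, map_sum, t2_tmul, t1_tmul]
  simp [bigT, sw_spec R₁, sw_spec R₂, sw_spec R₃, TensorProduct.tmul_sum, TensorProduct.sum_tmul]

section ten
variable {D : Type*} [AddCommGroup D] [Module k D] (T S : D ⊗[k] D →ₗ[k] D ⊗[k] D)

theorem tensor12_comp : tensor12 k D (T ∘ₗ S) = tensor12 k D T ∘ₗ tensor12 k D S := by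
  simp [tensor12, LinearMap.rTensor_comp]

theorem tensor23_comp : tensor23 k D (T ∘ₗ S) = tensor23 k D T ∘ₗ tensor23 k D S := by
  ext x y z
  simp [tensor23, LinearMap.lTensor_comp]

theorem flip23_flip23 (x) : flip23 k D (flip23 k D x) = x := by
  have : flip23 k D ∘ₗ flip23 k D = LinearMap.id := by
    ext x y z
    simp [flip23]
  exact LinearMap.congr_fun this x

theorem tensor13_comp : tensor13 k D (T ∘ₗ S) = tensor13 k D T ∘ₗ tensor13 k D S := by
  ext x y z
  simp [tensor13, tensor12_comp, flip23_flip23]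

theorem tensor12_tmul (x y z : D) :
    tensor12 k D T ((x ⊗ₜ[k] y) ⊗ₜ[k] z) = T (x ⊗ₜ[k] y) ⊗ₜ[k] z := rfl

theorem tensor23_tmul (x y z : D) :
    tensor23 k D T ((x ⊗ₜ[k] y) ⊗ₜ[k] z) =
      (TensorProduct.assoc k D D D).symm (x ⊗ₜ[k] T (y ⊗ₜ[k] z)) := rfl

theorem tensor13_tmul (x y z : D) :
    tensor13 k D T ((x ⊗ₜ[k] y) ⊗ₜ[k] z) = flip23 k D (T (x ⊗ₜ[k] z) ⊗ₜ[k] y) := rfl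

theorem flip23_tmul (x y z : D) :
    flip23 k D ((x ⊗ₜ[k] y) ⊗ₜ[k] z) = (x ⊗ₜ[k] z) ⊗ₜ[k] y := rfl

theorem mul12_tmul (m : D ⊗[k] D →ₗ[k] D) (x y z : D) :
    mul12 k D m ((x ⊗ₜ[k] y) ⊗ₜ[k] z) = m (x ⊗ₜ[k] y) ⊗ₜ[k] z := rfl

theorem mul23_tmul (m : D ⊗[k] D →ₗ[k] D) (x y z : D) :
    mul23 k D m ((x ⊗ₜ[k] y) ⊗ₜ[k] z) = x ⊗ₜ[k] m (y ⊗ₜ[k] z) := rfl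

end ten

variable (R₁ : B ⊗[k] A →ₗ[k] A ⊗[k] B) (R₂ : C ⊗[k] B →ₗ[k] B ⊗[k] C)
    (R₃ : C ⊗[k] A →ₗ[k] A ⊗[k] C)

/-- the conditions of the theorem in summation form -/
def Part1 : Prop := ∀ (a : A) (b : B) (c : C),
  ∑ p ∈ sw R₁ b a, ∑ q ∈ sw R₂ c p.2, p.1 ⊗ₜ[k] (q.1 ⊗ₜ[k] q.2) =
  ∑ q ∈ sw R₂ c b, ∑ p ∈ sw R₁ q.1 a, p.1 ⊗ₜ[k] (p.2 ⊗ₜ[k] q.2)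

/-- second condition -/
def Part2 : Prop := ∀ (a : A) (b : B) (c : C),
  ∑ p ∈ sw R₁ b a, ∑ q ∈ sw R₃ c p.1, q.1 ⊗ₜ[k] (p.2 ⊗ₜ[k] q.2) =
  ∑ q ∈ sw R₃ c a, ∑ p ∈ sw R₁ b q.1, p.1 ⊗ₜ[k] (p.2 ⊗ₜ[k] q.2)

/-- third condition -/
def Part3 : Prop := ∀ (a : A) (b : B) (c : C),
  ∑ p ∈ sw R₃ c a, ∑ q ∈ sw R₂ p.2 b, p.1 ⊗ₜ[k] (q.1 ⊗ₜ[k] q.2) =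
  ∑ q ∈ sw R₂ c b, ∑ p ∈ sw R₃ q.2 a, p.1 ⊗ₜ[k] (q.1 ⊗ₜ[k] p.2)


/-- insertion into the first slot -/
def insA (b : B) (c : C) : A →ₗ[k] DD k A B C :=
  (TensorProduct.mk k (A ⊗[k] B) C).flip c ∘ₗ (TensorProduct.mk k A B).flip b

/-- insertion into the second slot -/
def insB (a : A) (c : C) : B →ₗ[k] DD k A B C :=
  (TensorProduct.mk k (A ⊗[k] B) C).flip c ∘ₗ (TensorProduct.mk k A B) a

/-- insertion into the third slot -/
def insC (a : A) (b : B) : C →ₗ[k] DD k A B C :=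
  (TensorProduct.mk k (A ⊗[k] B) C) (a ⊗ₜ[k] b)

@[simp] theorem insA_apply (a : A) (b : B) (c : C) :
    insA (k := k) (A := A) b c a = (a ⊗ₜ[k] b) ⊗ₜ[k] c := rfl
@[simp] theorem insB_apply (a : A) (b : B) (c : C) :
    insB (k := k) (B := B) a c b = (a ⊗ₜ[k] b) ⊗ₜ[k] c := rfl
@[simp] theorem insC_apply (a : A) (b : B) (c : C) :
    insC (k := k) (C := C) a b c = (a ⊗ₜ[k] b) ⊗ₜ[k] c := rfl

/-- insertion of `A ⊗ (B ⊗ C)` into the third, second and first factors -/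
def ins (a a' : A) (b b'' : B) (c' c'' : C) :
    A ⊗[k] (B ⊗[k] C) →ₗ[k] (DD k A B C ⊗[k] DD k A B C) ⊗[k] DD k A B C :=
  TensorProduct.map (TensorProduct.map (insC a b) (insB a' c')) (insA b'' c'') ∘ₗ
    (TensorProduct.comm k A (C ⊗[k] B)).toLinearMap ∘ₗ
      (TensorProduct.comm k B C).toLinearMap.lTensor A

theorem ins_tmul (a a' : A) (b b'' : B) (c' c'' : C) (x : A) (y : B) (z : C) :
    ins a a' b b'' c' c'' (x ⊗ₜ[k] (y ⊗ₜ[k] z)) =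
      (((a ⊗ₜ[k] b) ⊗ₜ[k] z) ⊗ₜ[k] ((a' ⊗ₜ[k] y) ⊗ₜ[k] c')) ⊗ₜ[k] ((x ⊗ₜ[k] b'') ⊗ₜ[k] c'') := rfl

/-- insertion of `A ⊗ B` in `D ⊗ D` -/
def ins1 (a : A) (c : C) (b' : B) (c' : C) :
    A ⊗[k] B →ₗ[k] DD k A B C ⊗[k] DD k A B C :=
  TensorProduct.map (insB a c) (insA b' c') ∘ₗ (TensorProduct.comm k A B).toLinearMap

theorem ins1_tmul (a : A) (c : C) (b' : B) (c' : C) (x : A) (y : B) :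
    ins1 a c b' c' (x ⊗ₜ[k] y) =
      ((a ⊗ₜ[k] y) ⊗ₜ[k] c) ⊗ₜ[k] ((x ⊗ₜ[k] b') ⊗ₜ[k] c') := rfl

/-- insertion of `B ⊗ C` in `D ⊗ D` -/
def ins2 (a : A) (b : B) (a' : A) (c' : C) :
    B ⊗[k] C →ₗ[k] DD k A B C ⊗[k] DD k A B C :=
  TensorProduct.map (insC a b) (insB a' c') ∘ₗ (TensorProduct.comm k B C).toLinearMap

theorem ins2_tmul (a : A) (b : B) (a' : A) (c' : C) (x : B) (y : C) :
    ins2 a b a' c' (x ⊗ₜ[k] y) =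
      ((a ⊗ₜ[k] b) ⊗ₜ[k] y) ⊗ₜ[k] ((a' ⊗ₜ[k] x) ⊗ₜ[k] c') := rfl

/-- insertion of `A ⊗ C` in `D ⊗ D` -/
def ins3 (a : A) (b : B) (b' : B) (c' : C) :
    A ⊗[k] C →ₗ[k] DD k A B C ⊗[k] DD k A B C :=
  TensorProduct.map (insC a b) (insA b' c') ∘ₗ (TensorProduct.comm k A C).toLinearMap

theorem ins3_tmul (a : A) (b : B) (b' : B) (c' : C) (x : A) (y : C) :
    ins3 a b b' c' (x ⊗ₜ[k] y) =
      ((a ⊗ₜ[k] b) ⊗ₜ[k] y) ⊗ₜ[k] ((x ⊗ₜ[k] b') ⊗ₜ[k] c') := rfl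

section tw
variable {R₁ R₂ R₃}

theorem tw_mulA {R : B ⊗[k] A →ₗ[k] A ⊗[k] B} (h : IsTwistingMap k A B R) (b : B) (a a' : A) :
    ∑ p ∈ sw R b (a * a'), p.1 ⊗ₜ[k] p.2 =
      ∑ p ∈ sw R b a, ∑ q ∈ sw R p.2 a', (p.1 * q.1) ⊗ₜ[k] q.2 := by
  have := LinearMap.congr_fun h.mul_A ((b ⊗ₜ[k] a) ⊗ₜ[k] a')
  simpa [sw_spec R, TensorProduct.tmul_sum, TensorProduct.sum_tmul] using this

theorem tw_mulB {R : B ⊗[k] A →ₗ[k] A ⊗[k] B} (h : IsTwistingMap k A B R) (b b' : B) (a : A) :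
    ∑ p ∈ sw R (b * b') a, p.1 ⊗ₜ[k] p.2 =
      ∑ p ∈ sw R b' a, ∑ q ∈ sw R b p.1, q.1 ⊗ₜ[k] (q.2 * p.2) := by
  have := LinearMap.congr_fun h.mul_B (b ⊗ₜ[k] (b' ⊗ₜ[k] a))
  simpa [sw_spec R, TensorProduct.tmul_sum, TensorProduct.sum_tmul] using this

theorem t1_mul23 (h : IsTwistingMap k A B R₁) :
    t1 R₁ ∘ₗ mul23 k (DD k A B C) (LinearMap.mul' k (DD k A B C)) =
    mul23 k (DD k A B C) (LinearMap.mul' k (DD k A B C)) ∘ₗ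
      tensor13 k (DD k A B C) (t1 R₁) ∘ₗ tensor12 k (DD k A B C) (t1 R₁) := by
  apply ext3
  intro a a' a'' b b' b'' c c' c''
  have := congrArg (ins1 a c (b' * b'') (c' * c'')) (tw_mulA h b a' a'')
  simpa only [LinearMap.comp_apply, mul23_tmul, tensor12_tmul, tensor13_tmul, t1_tmul, map_sum,
    TensorProduct.sum_tmul, TensorProduct.tmul_sum, flip23_tmul, LinearMap.mul'_apply,
    Algebra.TensorProduct.tmul_mul_tmul, ins1_tmul] using this

theorem t2_mul23 (h : IsTwistingMap k B C R₂) :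
    t2 R₂ ∘ₗ mul23 k (DD k A B C) (LinearMap.mul' k (DD k A B C)) =
    mul23 k (DD k A B C) (LinearMap.mul' k (DD k A B C)) ∘ₗ
      tensor13 k (DD k A B C) (t2 R₂) ∘ₗ tensor12 k (DD k A B C) (t2 R₂) := by
  apply ext3
  intro a a' a'' b b' b'' c c' c''
  have := congrArg (ins2 a b (a' * a'') (c' * c'')) (tw_mulA h c b' b'')
  simpa only [LinearMap.comp_apply, mul23_tmul, tensor12_tmul, tensor13_tmul, t2_tmul, map_sum,
    TensorProduct.sum_tmul, TensorProduct.tmul_sum, flip23_tmul, LinearMap.mul'_apply,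
    Algebra.TensorProduct.tmul_mul_tmul, ins2_tmul] using this

theorem t3_mul23 (h : IsTwistingMap k A C R₃) :
    t3 R₃ ∘ₗ mul23 k (DD k A B C) (LinearMap.mul' k (DD k A B C)) =
    mul23 k (DD k A B C) (LinearMap.mul' k (DD k A B C)) ∘ₗ
      tensor13 k (DD k A B C) (t3 R₃) ∘ₗ tensor12 k (DD k A B C) (t3 R₃) := by
  apply ext3
  intro a a' a'' b b' b'' c c' c''
  have := congrArg (ins3 a b (b' * b'') (c' * c'')) (tw_mulA h c a' a'')
  simpa only [LinearMap.comp_apply, mul23_tmul, tensor12_tmul, tensor13_tmul, t3_tmul, map_sum,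
    TensorProduct.sum_tmul, TensorProduct.tmul_sum, flip23_tmul, LinearMap.mul'_apply,
    Algebra.TensorProduct.tmul_mul_tmul, ins3_tmul] using this

theorem t1_mul12 (h : IsTwistingMap k A B R₁) :
    t1 R₁ ∘ₗ mul12 k (DD k A B C) (LinearMap.mul' k (DD k A B C)) =
    mul12 k (DD k A B C) (LinearMap.mul' k (DD k A B C)) ∘ₗ
      tensor13 k (DD k A B C) (t1 R₁) ∘ₗ tensor23 k (DD k A B C) (t1 R₁) := by
  apply ext3
  intro a a' a'' b b' b'' c c' c''
  have := congrArg (ins1 (a * a') (c * c') b'' c'') (tw_mulB h b b' a'')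
  simpa only [LinearMap.comp_apply, mul12_tmul, tensor23_tmul, tensor13_tmul, t1_tmul, map_sum,
    TensorProduct.sum_tmul, TensorProduct.tmul_sum, flip23_tmul, LinearMap.mul'_apply,
    Algebra.TensorProduct.tmul_mul_tmul, ins1_tmul, TensorProduct.assoc_symm_tmul] using this

theorem t2_mul12 (h : IsTwistingMap k B C R₂) :
    t2 R₂ ∘ₗ mul12 k (DD k A B C) (LinearMap.mul' k (DD k A B C)) =
    mul12 k (DD k A B C) (LinearMap.mul' k (DD k A B C)) ∘ₗ
      tensor13 k (DD k A B C) (t2 R₂) ∘ₗ tensor23 k (DD k A B C) (t2 R₂) := by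
  apply ext3
  intro a a' a'' b b' b'' c c' c''
  have := congrArg (ins2 (a * a') (b * b') a'' c'') (tw_mulB h c c' b'')
  simpa only [LinearMap.comp_apply, mul12_tmul, tensor23_tmul, tensor13_tmul, t2_tmul, map_sum,
    TensorProduct.sum_tmul, TensorProduct.tmul_sum, flip23_tmul, LinearMap.mul'_apply,
    Algebra.TensorProduct.tmul_mul_tmul, ins2_tmul, TensorProduct.assoc_symm_tmul] using this

theorem t3_mul12 (h : IsTwistingMap k A C R₃) :
    t3 R₃ ∘ₗ mul12 k (DD k A B C) (LinearMap.mul' k (DD k A B C)) =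
    mul12 k (DD k A B C) (LinearMap.mul' k (DD k A B C)) ∘ₗ
      tensor13 k (DD k A B C) (t3 R₃) ∘ₗ tensor23 k (DD k A B C) (t3 R₃) := by
  apply ext3
  intro a a' a'' b b' b'' c c' c''
  have := congrArg (ins3 (a * a') (b * b') b'' c'') (tw_mulB h c c' a'')
  simpa only [LinearMap.comp_apply, mul12_tmul, tensor23_tmul, tensor13_tmul, t3_tmul, map_sum,
    TensorProduct.sum_tmul, TensorProduct.tmul_sum, flip23_tmul, LinearMap.mul'_apply,
    Algebra.TensorProduct.tmul_mul_tmul, ins3_tmul, TensorProduct.assoc_symm_tmul] using this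

end tw

/-- commuting endomorphisms of a vector space -/
abbrev Cm {M : Type*} [AddCommMonoid M] [Module k M] (f g : M →ₗ[k] M) : Prop :=
  f ∘ₗ g = g ∘ₗ f

/-- operators acting on disjoint tensor slots commute -/
theorem comm_disjoint :
    Cm (tensor12 k (DD k A B C) (t1 R₁)) (tensor23 k (DD k A B C) (t1 R₁)) ∧
    Cm (tensor12 k (DD k A B C) (t1 R₁)) (tensor23 k (DD k A B C) (t2 R₂)) ∧
    Cm (tensor12 k (DD k A B C) (t1 R₁)) (tensor23 k (DD k A B C) (t3 R₃)) ∧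
    Cm (tensor12 k (DD k A B C) (t2 R₂)) (tensor23 k (DD k A B C) (t2 R₂)) ∧
    Cm (tensor12 k (DD k A B C) (t2 R₂)) (tensor23 k (DD k A B C) (t3 R₃)) ∧
    Cm (tensor12 k (DD k A B C) (t3 R₃)) (tensor23 k (DD k A B C) (t1 R₁)) ∧
    Cm (tensor12 k (DD k A B C) (t3 R₃)) (tensor23 k (DD k A B C) (t2 R₂)) ∧
    Cm (tensor12 k (DD k A B C) (t3 R₃)) (tensor23 k (DD k A B C) (t3 R₃)) ∧
    Cm (tensor12 k (DD k A B C) (t1 R₁)) (tensor13 k (DD k A B C) (t2 R₂)) ∧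
    Cm (tensor12 k (DD k A B C) (t1 R₁)) (tensor13 k (DD k A B C) (t3 R₃)) ∧
    Cm (tensor23 k (DD k A B C) (t1 R₁)) (tensor13 k (DD k A B C) (t2 R₂)) ∧
    Cm (tensor23 k (DD k A B C) (t2 R₂)) (tensor13 k (DD k A B C) (t3 R₃)) := by
  refine ⟨?_, ?_, ?_, ?_, ?_, ?_, ?_, ?_, ?_, ?_, ?_, ?_⟩
  all_goals
    apply ext3
    intro a a' a'' b b' b'' c c' c''
    simp only [LinearMap.comp_apply, tensor12_tmul, tensor23_tmul, tensor13_tmul, t1_tmul,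
      t2_tmul, t3_tmul, map_sum, TensorProduct.sum_tmul, TensorProduct.tmul_sum, flip23_tmul,
      TensorProduct.assoc_symm_tmul]
    rw [Finset.sum_comm]

theorem comm_2_12_1_23 (h : Part1 R₁ R₂) :
    tensor12 k (DD k A B C) (t2 R₂) ∘ₗ tensor23 k (DD k A B C) (t1 R₁) =
    tensor23 k (DD k A B C) (t1 R₁) ∘ₗ tensor12 k (DD k A B C) (t2 R₂) := by
  apply ext3
  intro a a' a'' b b' b'' c c' c''
  have := congrArg (ins a a' b b'' c' c'') (h a'' b' c)
  simpa only [LinearMap.comp_apply, tensor12_tmul, tensor23_tmul, tensor13_tmul, t1_tmul,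
    t2_tmul, t3_tmul, map_sum, TensorProduct.sum_tmul, TensorProduct.tmul_sum, flip23_tmul,
    TensorProduct.assoc_symm_tmul, ins_tmul] using this

theorem comm_2_12_3_13 (h : Part3 R₂ R₃) :
    tensor12 k (DD k A B C) (t2 R₂) ∘ₗ tensor13 k (DD k A B C) (t3 R₃) =
    tensor13 k (DD k A B C) (t3 R₃) ∘ₗ tensor12 k (DD k A B C) (t2 R₂) := by
  apply ext3
  intro a a' a'' b b' b'' c c' c''
  have := congrArg (ins a a' b b'' c' c'') (h a'' b' c)
  simpa only [LinearMap.comp_apply, tensor12_tmul, tensor23_tmul, tensor13_tmul, t1_tmul,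
    t2_tmul, t3_tmul, map_sum, TensorProduct.sum_tmul, TensorProduct.tmul_sum, flip23_tmul,
    TensorProduct.assoc_symm_tmul, ins_tmul] using this

theorem comm_1_23_3_13 (h : Part2 R₁ R₃) :
    tensor23 k (DD k A B C) (t1 R₁) ∘ₗ tensor13 k (DD k A B C) (t3 R₃) =
    tensor13 k (DD k A B C) (t3 R₃) ∘ₗ tensor23 k (DD k A B C) (t1 R₁) := by
  apply ext3
  intro a a' a'' b b' b'' c c' c''
  have := congrArg (ins a a' b b'' c' c'') (h a'' b' c)
  simpa only [LinearMap.comp_apply, tensor12_tmul, tensor23_tmul, tensor13_tmul, t1_tmul,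
    t2_tmul, t3_tmul, map_sum, TensorProduct.sum_tmul, TensorProduct.tmul_sum, flip23_tmul,
    TensorProduct.assoc_symm_tmul, ins_tmul] using this.symm


theorem isTwistor_of_parts (hR₁ : IsTwistingMap k A B R₁) (hR₂ : IsTwistingMap k B C R₂)
    (hR₃ : IsTwistingMap k A C R₃) (h1 : Part1 R₁ R₂) (h2 : Part2 R₁ R₃) (h3 : Part3 R₂ R₃) :
    IsTwistor k (DD k A B C) (LinearMap.mul' k (DD k A B C)) 1 (bigT k A B C R₁ R₂ R₃) where
  one_left d := by
    have : bigT k A B C R₁ R₂ R₃ ∘ₗ (TensorProduct.mk k (DD k A B C) (DD k A B C)) 1 =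
        (TensorProduct.mk k (DD k A B C) (DD k A B C)) 1 := by
      ext a b c
      simp [Algebra.TensorProduct.one_def, bigT, hR₁.unit_A, hR₂.unit_A, hR₃.unit_A]
    exact LinearMap.congr_fun this d
  one_right d := by
    have : bigT k A B C R₁ R₂ R₃ ∘ₗ (TensorProduct.mk k (DD k A B C) (DD k A B C)).flip 1 =
        (TensorProduct.mk k (DD k A B C) (DD k A B C)).flip 1 := by
      ext a b c
      simp [Algebra.TensorProduct.one_def, bigT, hR₁.unit_B, hR₂.unit_B, hR₃.unit_B]
    exact LinearMap.congr_fun this d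
  mul_right := by
    obtain ⟨d0, d1, d2, d3, d4, d5, d6, d7, d8, d9, d10, d11⟩ :=
      comm_disjoint R₁ R₂ R₃
    rw [bigT_eq]
    simp only [tensor12_comp, tensor13_comp]
    refine LinearMap.ext fun x => ?_
    have m1 := LinearMap.congr_fun (t1_mul23 (C := C) hR₁)
    have m2 := LinearMap.congr_fun (t2_mul23 (A := A) hR₂)
    have m3 := LinearMap.congr_fun (t3_mul23 (B := B) hR₃)
    have c1 := LinearMap.congr_fun d8
    have c2 := LinearMap.congr_fun d9
    have c3 := LinearMap.congr_fun (comm_2_12_3_13 R₂ R₃ h3)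
    simp only [LinearMap.comp_apply] at m1 m2 m3 c1 c2 c3 ⊢
    simp only [m1, m2, m3, c1, c2, c3]
  mul_left := by
    obtain ⟨d0, d1, d2, d3, d4, d5, d6, d7, d8, d9, d10, d11⟩ :=
      comm_disjoint R₁ R₂ R₃
    rw [bigT_eq]
    simp only [tensor23_comp, tensor13_comp]
    refine LinearMap.ext fun x => ?_
    have m1 := LinearMap.congr_fun (t1_mul12 (C := C) hR₁)
    have m2 := LinearMap.congr_fun (t2_mul12 (A := A) hR₂)
    have m3 := LinearMap.congr_fun (t3_mul12 (B := B) hR₃)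
    have c1 := LinearMap.congr_fun d10
    have c2 := LinearMap.congr_fun (comm_1_23_3_13 R₁ R₃ h2)
    have c3 := LinearMap.congr_fun d11
    simp only [LinearMap.comp_apply] at m1 m2 m3 c1 c2 c3 ⊢
    simp only [m1, m2, m3, c1, c2, c3]
  comm1223 := by
    obtain ⟨d0, d1, d2, d3, d4, d5, d6, d7, d8, d9, d10, d11⟩ :=
      comm_disjoint R₁ R₂ R₃
    rw [bigT_eq]
    simp only [tensor12_comp, tensor23_comp]
    refine LinearMap.ext fun x => ?_
    have c11 := LinearMap.congr_fun d0
    have c12 := LinearMap.congr_fun d1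
    have c13 := LinearMap.congr_fun d2
    have c21 := LinearMap.congr_fun (comm_2_12_1_23 R₁ R₂ h1)
    have c22 := LinearMap.congr_fun d3
    have c23 := LinearMap.congr_fun d4
    have c31 := LinearMap.congr_fun d5
    have c32 := LinearMap.congr_fun d6
    have c33 := LinearMap.congr_fun d7
    simp only [LinearMap.comp_apply] at c11 c12 c13 c21 c22 c23 c31 c32 c33 ⊢
    simp only [c11, c12, c13, c21, c22, c23, c31, c32, c33]

section units
variable {R₁ R₂ R₃}

theorem bigT_23 (hR₁ : IsTwistingMap k A B R₁) (a : A) (b : B) (c : C) :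
    bigT k A B C R₁ R₂ R₃ ((((1 : A) ⊗ₜ[k] (1 : B)) ⊗ₜ[k] c) ⊗ₜ[k] ((a ⊗ₜ[k] b) ⊗ₜ[k] (1 : C))) =
      ∑ p ∈ sw R₃ c a, ∑ q ∈ sw R₂ p.2 b, (((1 : A) ⊗ₜ[k] (1 : B)) ⊗ₜ[k] q.2) ⊗ₜ[k]
        ((p.1 ⊗ₜ[k] q.1) ⊗ₜ[k] (1 : C)) := by
  simp [bigT, hR₁.unit_A, sw_spec R₂, sw_spec R₃, TensorProduct.tmul_sum, TensorProduct.sum_tmul]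

theorem bigT_13 (hR₂ : IsTwistingMap k B C R₂) (a : A) (b : B) (c : C) :
    bigT k A B C R₁ R₂ R₃ ((((1 : A) ⊗ₜ[k] b) ⊗ₜ[k] c) ⊗ₜ[k] ((a ⊗ₜ[k] (1 : B)) ⊗ₜ[k] (1 : C))) =
      ∑ q ∈ sw R₃ c a, ∑ p ∈ sw R₁ b q.1, (((1 : A) ⊗ₜ[k] p.2) ⊗ₜ[k] q.2) ⊗ₜ[k]
        ((p.1 ⊗ₜ[k] (1 : B)) ⊗ₜ[k] (1 : C)) := by
  simp [bigT, hR₂.unit_B, sw_spec R₁, sw_spec R₃, TensorProduct.tmul_sum, TensorProduct.sum_tmul]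

theorem bigT_1 (hR₂ : IsTwistingMap k B C R₂) (hR₃ : IsTwistingMap k A C R₃) (a : A) (b : B) :
    bigT k A B C R₁ R₂ R₃
      ((((1 : A) ⊗ₜ[k] b) ⊗ₜ[k] (1 : C)) ⊗ₜ[k] ((a ⊗ₜ[k] (1 : B)) ⊗ₜ[k] (1 : C))) =
      ∑ p ∈ sw R₁ b a, (((1 : A) ⊗ₜ[k] p.2) ⊗ₜ[k] (1 : C)) ⊗ₜ[k]
        ((p.1 ⊗ₜ[k] (1 : B)) ⊗ₜ[k] (1 : C)) := by
  simp [bigT, hR₂.unit_B, hR₃.unit_A, sw_spec R₁, TensorProduct.tmul_sum, TensorProduct.sum_tmul]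

theorem bigT_2 (hR₁ : IsTwistingMap k A B R₁) (hR₃ : IsTwistingMap k A C R₃) (b : B) (c : C) :
    bigT k A B C R₁ R₂ R₃
      ((((1 : A) ⊗ₜ[k] (1 : B)) ⊗ₜ[k] c) ⊗ₜ[k] (((1 : A) ⊗ₜ[k] b) ⊗ₜ[k] (1 : C))) =
      ∑ q ∈ sw R₂ c b, (((1 : A) ⊗ₜ[k] (1 : B)) ⊗ₜ[k] q.2) ⊗ₜ[k]
        (((1 : A) ⊗ₜ[k] q.1) ⊗ₜ[k] (1 : C)) := by
  simp [bigT, hR₁.unit_A, hR₃.unit_B, sw_spec R₂, TensorProduct.tmul_sum, TensorProduct.sum_tmul]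

theorem bigT_3 (hR₁ : IsTwistingMap k A B R₁) (hR₂ : IsTwistingMap k B C R₂) (a : A) (c : C) :
    bigT k A B C R₁ R₂ R₃
      ((((1 : A) ⊗ₜ[k] (1 : B)) ⊗ₜ[k] c) ⊗ₜ[k] ((a ⊗ₜ[k] (1 : B)) ⊗ₜ[k] (1 : C))) =
      ∑ p ∈ sw R₃ c a, (((1 : A) ⊗ₜ[k] (1 : B)) ⊗ₜ[k] p.2) ⊗ₜ[k]
        ((p.1 ⊗ₜ[k] (1 : B)) ⊗ₜ[k] (1 : C)) := by
  simp [bigT, hR₁.unit_A, hR₂.unit_B, sw_spec R₃, TensorProduct.tmul_sum, TensorProduct.sum_tmul]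

end units

variable (k A B C) in
/-- multiplication `D ⊗ D → D`, reassociated -/
def ml : DD k A B C ⊗[k] DD k A B C →ₗ[k] A ⊗[k] (B ⊗[k] C) :=
  (TensorProduct.assoc k A B C).toLinearMap ∘ₗ LinearMap.mul' k (DD k A B C)

theorem ml_tmul (a a' : A) (b b' : B) (c c' : C) :
    ml k A B C (((a ⊗ₜ[k] b) ⊗ₜ[k] c) ⊗ₜ[k] ((a' ⊗ₜ[k] b') ⊗ₜ[k] c')) =
      (a * a') ⊗ₜ[k] ((b * b') ⊗ₜ[k] (c * c')) := by
  simp [ml]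

variable (k) in
/-- the test element -/
def tst (a : A) (b : B) (c : C) : (DD k A B C ⊗[k] DD k A B C) ⊗[k] DD k A B C :=
  ((((1 : A) ⊗ₜ[k] (1 : B)) ⊗ₜ[k] c) ⊗ₜ[k] (((1 : A) ⊗ₜ[k] b) ⊗ₜ[k] (1 : C))) ⊗ₜ[k]
    ((a ⊗ₜ[k] (1 : B)) ⊗ₜ[k] (1 : C))

theorem parts_of_isTwistor (hR₁ : IsTwistingMap k A B R₁) (hR₂ : IsTwistingMap k B C R₂)
    (hR₃ : IsTwistingMap k A C R₃)
    (h : IsTwistor k (DD k A B C) (LinearMap.mul' k (DD k A B C)) 1 (bigT k A B C R₁ R₂ R₃)) :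
    Part1 R₁ R₂ ∧ Part2 R₁ R₃ ∧ Part3 R₂ R₃ := by
  refine ⟨fun a b c => ?_, fun a b c => ?_, fun a b c => ?_⟩
  · have := congrArg (fun z => ml k A B C (mul12 k (DD k A B C) (LinearMap.mul' k (DD k A B C)) z))
      (LinearMap.congr_fun h.comm1223 (tst k a b c))
    simpa only [tst, LinearMap.comp_apply, tensor12_tmul, tensor23_tmul,
      bigT_1 hR₂ hR₃, bigT_2 hR₁ hR₃, map_sum, TensorProduct.sum_tmul, TensorProduct.tmul_sum,
      TensorProduct.assoc_symm_tmul, mul12_tmul, LinearMap.mul'_apply,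
      Algebra.TensorProduct.tmul_mul_tmul, one_mul, mul_one, ml_tmul] using this
  · have := congrArg (ml k A B C) (LinearMap.congr_fun h.mul_left (tst k a b c))
    simpa only [tst, LinearMap.comp_apply, tensor13_tmul, tensor23_tmul, flip23_tmul,
      bigT_1 hR₂ hR₃, bigT_3 hR₁ hR₂, bigT_13 hR₂, map_sum, TensorProduct.sum_tmul,
      TensorProduct.tmul_sum,
      TensorProduct.assoc_symm_tmul, mul12_tmul, LinearMap.mul'_apply,
      Algebra.TensorProduct.tmul_mul_tmul, one_mul, mul_one, ml_tmul] using this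
  · have := congrArg (ml k A B C) (LinearMap.congr_fun h.mul_right (tst k a b c))
    simpa only [tst, LinearMap.comp_apply, tensor13_tmul, tensor12_tmul, flip23_tmul,
      bigT_2 hR₁ hR₃, bigT_3 hR₁ hR₂, bigT_23 hR₁, map_sum, TensorProduct.sum_tmul,
      TensorProduct.tmul_sum, mul23_tmul, LinearMap.mul'_apply,
      Algebra.TensorProduct.tmul_mul_tmul, one_mul, mul_one, ml_tmul] using this.symm

theorem compat_of_parts (h1 : Part1 R₁ R₂) (h2 : Part2 R₁ R₃) (h3 : Part3 R₂ R₃)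
    (a : A) (b : B) (c : C) :
    ∑ p ∈ sw R₁ b a, ∑ q ∈ sw R₃ c p.1, ∑ r ∈ sw R₂ q.2 p.2, q.1 ⊗ₜ[k] (r.1 ⊗ₜ[k] r.2) =
    ∑ r ∈ sw R₂ c b, ∑ q ∈ sw R₃ r.2 a, ∑ p ∈ sw R₁ r.1 q.1, p.1 ⊗ₜ[k] (p.2 ⊗ₜ[k] q.2) := by
  have c1 := LinearMap.congr_fun (comm_2_12_1_23 R₁ R₂ h1)
  have c2 := LinearMap.congr_fun (comm_1_23_3_13 R₁ R₃ h2)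
  have c3 := LinearMap.congr_fun (comm_2_12_3_13 R₂ R₃ h3)
  simp only [LinearMap.comp_apply] at c1 c2 c3
  have key : tensor12 k (DD k A B C) (t2 R₂) (tensor13 k (DD k A B C) (t3 R₃)
      (tensor23 k (DD k A B C) (t1 R₁) (tst k a b c))) =
    tensor23 k (DD k A B C) (t1 R₁) (tensor13 k (DD k A B C) (t3 R₃)
      (tensor12 k (DD k A B C) (t2 R₂) (tst k a b c))) := by
    rw [c3, c1, c2]
  have := congrArg (fun z => ml k A B C (mul12 k (DD k A B C) (LinearMap.mul' k (DD k A B C)) z)) key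
  simpa only [tst, tensor12_tmul, tensor23_tmul, tensor13_tmul, t1_tmul, t2_tmul, t3_tmul,
    map_sum, TensorProduct.sum_tmul, TensorProduct.tmul_sum, flip23_tmul,
    TensorProduct.assoc_symm_tmul, mul12_tmul, LinearMap.mul'_apply,
    Algebra.TensorProduct.tmul_mul_tmul, one_mul, mul_one, ml_tmul] using this

theorem ext_cba {M : Type*} [AddCommMonoid M] [Module k M] {f g : C ⊗[k] (B ⊗[k] A) →ₗ[k] M} :
    f = g ↔ ∀ (a : A) (b : B) (c : C),
      f (c ⊗ₜ[k] (b ⊗ₜ[k] a)) = g (c ⊗ₜ[k] (b ⊗ₜ[k] a)) := by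
  constructor
  · rintro rfl a b c
    rfl
  · intro h
    ext c b a
    exact h a b c

end Helpers

/-- Proposition 4.1 (Proposition `twisttrei`): given twisting maps `R₁ : B ⊗ A → A ⊗ B`,
`R₂ : C ⊗ B → B ⊗ C`, `R₃ : C ⊗ A → A ⊗ C`, the map `T` on `(A ⊗ B ⊗ C) ⊗ (A ⊗ B ⊗ C)`
is a twistor for `D = A ⊗ B ⊗ C` if and only if the three compatibility conditions
`a_{R₁} ⊗ (b_{R₁})_{R₂} ⊗ c_{R₂} = a_{R₁} ⊗ (b_{R₂})_{R₁} ⊗ c_{R₂}`,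
`(a_{R₁})_{R₃} ⊗ b_{R₁} ⊗ c_{R₃} = (a_{R₃})_{R₁} ⊗ b_{R₁} ⊗ c_{R₃}` and
`a_{R₃} ⊗ b_{R₂} ⊗ (c_{R₃})_{R₂} = a_{R₃} ⊗ b_{R₂} ⊗ (c_{R₂})_{R₃}` hold; moreover in that
case `R₁`, `R₂`, `R₃` are compatible. -/
theorem three_twisting_maps (k : Type*) [Field k] (A B C : Type*)
    [Ring A] [Algebra k A] [Ring B] [Algebra k B] [Ring C] [Algebra k C]
    (R₁ : B ⊗[k] A →ₗ[k] A ⊗[k] B) (R₂ : C ⊗[k] B →ₗ[k] B ⊗[k] C)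
    (R₃ : C ⊗[k] A →ₗ[k] A ⊗[k] C)
    (hR₁ : IsTwistingMap k A B R₁) (hR₂ : IsTwistingMap k B C R₂)
    (hR₃ : IsTwistingMap k A C R₃) :
    (IsTwistor k ((A ⊗[k] B) ⊗[k] C) (LinearMap.mul' k ((A ⊗[k] B) ⊗[k] C)) 1
        (bigT k A B C R₁ R₂ R₃) ↔
      -- (part1) : a_{R₁} ⊗ (b_{R₁})_{R₂} ⊗ c_{R₂} = a_{R₁} ⊗ (b_{R₂})_{R₁} ⊗ c_{R₂}
      (((TensorProduct.comm k (B ⊗[k] C) A).toLinearMap ∘ₗ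
          R₂.rTensor A ∘ₗ
          (TensorProduct.assoc k C B A).symm.toLinearMap ∘ₗ
          (TensorProduct.comm k A B).toLinearMap.lTensor C ∘ₗ
          R₁.lTensor C :
          C ⊗[k] (B ⊗[k] A) →ₗ[k] A ⊗[k] (B ⊗[k] C)) =
        (TensorProduct.assoc k A B C).toLinearMap ∘ₗ
          R₁.rTensor C ∘ₗ
          (TensorProduct.assoc k B A C).symm.toLinearMap ∘ₗ
          (TensorProduct.comm k C A).toLinearMap.lTensor B ∘ₗ
          (TensorProduct.assoc k B C A).toLinearMap ∘ₗ
          R₂.rTensor A ∘ₗ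
          (TensorProduct.assoc k C B A).symm.toLinearMap) ∧
      -- (part2) : (a_{R₁})_{R₃} ⊗ b_{R₁} ⊗ c_{R₃} = (a_{R₃})_{R₁} ⊗ b_{R₁} ⊗ c_{R₃}
      (((TensorProduct.comm k C B).toLinearMap.lTensor A ∘ₗ
          (TensorProduct.assoc k A C B).toLinearMap ∘ₗ
          R₃.rTensor B ∘ₗ
          (TensorProduct.assoc k C A B).symm.toLinearMap ∘ₗ
          R₁.lTensor C :
          C ⊗[k] (B ⊗[k] A) →ₗ[k] A ⊗[k] (B ⊗[k] C)) =
        (TensorProduct.assoc k A B C).toLinearMap ∘ₗ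
          R₁.rTensor C ∘ₗ
          (TensorProduct.comm k A B).toLinearMap.rTensor C ∘ₗ
          (TensorProduct.assoc k A B C).symm.toLinearMap ∘ₗ
          (TensorProduct.comm k C B).toLinearMap.lTensor A ∘ₗ
          (TensorProduct.assoc k A C B).toLinearMap ∘ₗ
          R₃.rTensor B ∘ₗ
          (TensorProduct.assoc k C A B).symm.toLinearMap ∘ₗ
          (TensorProduct.comm k B A).toLinearMap.lTensor C) ∧
      -- (part3) : a_{R₃} ⊗ b_{R₂} ⊗ (c_{R₃})_{R₂} = a_{R₃} ⊗ b_{R₂} ⊗ (c_{R₂})_{R₃}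
      ((R₂.lTensor A ∘ₗ
          (TensorProduct.assoc k A C B).toLinearMap ∘ₗ
          R₃.rTensor B ∘ₗ
          (TensorProduct.assoc k C A B).symm.toLinearMap ∘ₗ
          (TensorProduct.comm k B A).toLinearMap.lTensor C :
          C ⊗[k] (B ⊗[k] A) →ₗ[k] A ⊗[k] (B ⊗[k] C)) =
        (TensorProduct.assoc k A B C).toLinearMap ∘ₗ
          (TensorProduct.comm k B A).toLinearMap.rTensor C ∘ₗ
          (TensorProduct.assoc k B A C).symm.toLinearMap ∘ₗ
          R₃.lTensor B ∘ₗ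
          (TensorProduct.assoc k B C A).toLinearMap ∘ₗ
          R₂.rTensor A ∘ₗ
          (TensorProduct.assoc k C B A).symm.toLinearMap)) ∧
    (IsTwistor k ((A ⊗[k] B) ⊗[k] C) (LinearMap.mul' k ((A ⊗[k] B) ⊗[k] C)) 1
        (bigT k A B C R₁ R₂ R₃) →
      -- compatibility : (id_A ⊗ R₂) ∘ (R₃ ⊗ id_B) ∘ (id_C ⊗ R₁)
      --              = (R₁ ⊗ id_C) ∘ (id_B ⊗ R₃) ∘ (R₂ ⊗ id_A)
      (R₂.lTensor A ∘ₗ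
          (TensorProduct.assoc k A C B).toLinearMap ∘ₗ
          R₃.rTensor B ∘ₗ
          (TensorProduct.assoc k C A B).symm.toLinearMap ∘ₗ
          R₁.lTensor C :
          C ⊗[k] (B ⊗[k] A) →ₗ[k] A ⊗[k] (B ⊗[k] C)) =
        (TensorProduct.assoc k A B C).toLinearMap ∘ₗ
          R₁.rTensor C ∘ₗ
          (TensorProduct.assoc k B A C).symm.toLinearMap ∘ₗ
          R₃.lTensor B ∘ₗ
          (TensorProduct.assoc k B C A).toLinearMap ∘ₗ
          R₂.rTensor A ∘ₗ
          (TensorProduct.assoc k C B A).symm.toLinearMap) := by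
  have hiff : IsTwistor k ((A ⊗[k] B) ⊗[k] C) (LinearMap.mul' k ((A ⊗[k] B) ⊗[k] C)) 1
      (bigT k A B C R₁ R₂ R₃) ↔ (Part1 R₁ R₂ ∧ Part2 R₁ R₃ ∧ Part3 R₂ R₃) :=
    ⟨parts_of_isTwistor R₁ R₂ R₃ hR₁ hR₂ hR₃,
      fun h => isTwistor_of_parts R₁ R₂ R₃ hR₁ hR₂ hR₃ h.1 h.2.1 h.2.2⟩
  refine ⟨hiff.trans (and_congr ?_ (and_congr ?_ ?_)), fun h => ?_⟩
  · rw [ext_cba, Part1]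
    simp [sw_spec R₁, sw_spec R₂, TensorProduct.tmul_sum, TensorProduct.sum_tmul]
  · rw [ext_cba, Part2]
    simp [sw_spec R₁, sw_spec R₃, TensorProduct.tmul_sum, TensorProduct.sum_tmul]
  · rw [ext_cba, Part3]
    simp [sw_spec R₂, sw_spec R₃, TensorProduct.tmul_sum, TensorProduct.sum_tmul]
  · obtain ⟨h1, h2, h3⟩ := hiff.1 h
    rw [ext_cba]
    intro a b c
    have := compat_of_parts R₁ R₂ R₃ h1 h2 h3 a b c
    simpa [sw_spec R₁, sw_spec R₂, sw_spec R₃, TensorProduct.tmul_sum,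
      TensorProduct.sum_tmul] using this
end
end

section
/- Let D be an associative unital algebra over a field k and let δ : D → D be a linear map satisfying δ(dd') = δ(d)d' + dδ(d') for all d, d' ∈ D and δ ∘ δ = 0. Then the linear map T : D ⊗ D → D ⊗ D defined by T(d ⊗ d') = d ⊗ d' + δ(d) ⊗ δ(d') is a twistor for D. -/
open TensorProduct

noncomputable section

/-- Example (vi) of Section 4: if `δ : D → D` is a derivation with `δ² = 0`, then
`T(d ⊗ d') = d ⊗ d' + δ(d) ⊗ δ(d')` is a twistor for `D`. -/
theorem derivation_twistor (k : Type*) [Field k] (D : Type*) [Ring D] [Algebra k D]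
    (δ : D →ₗ[k] D) (hder : ∀ d d' : D, δ (d * d') = δ d * d' + d * δ d')
    (hsq : δ ∘ₗ δ = 0) :
    IsTwistor k D (LinearMap.mul' k D) 1
      (LinearMap.id + TensorProduct.map δ δ) := by
  have h2 : ∀ d, δ (δ d) = 0 := fun d => by simpa using LinearMap.congr_fun hsq d
  have h1 : δ 1 = 0 := by
    have h := hder 1 1
    simpa using h
  constructor
  · intro d
    simp [h1]
  · intro d
    simp [h1]
  · apply TensorProduct.ext_threefold
    intro a b c
    simp [mul23, tensor13, tensor12, flip23, hder, h2, TensorProduct.add_tmul,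
      TensorProduct.tmul_add]
    try abel
  · apply TensorProduct.ext_threefold
    intro a b c
    simp [mul12, tensor13, tensor12, tensor23, flip23, hder, h2, TensorProduct.add_tmul,
      TensorProduct.tmul_add]
    try abel
  · apply TensorProduct.ext_threefold
    intro a b c
    simp [tensor12, tensor23, h2, TensorProduct.add_tmul, TensorProduct.tmul_add]
    try abel
end
end

section
/- Let D be an associative unital algebra over a field k with multiplication μ, T a twistor for D, and V a k-vector space with a left D-module structure λ : D ⊗ V → V (so λ(1 ⊗ v) = v for all v ∈ V and λ ∘ (μ ⊗ id_V) = λ ∘ (id_D ⊗ λ)). Let Γ : D ⊗ V → D ⊗ V be a linear map such that Γ(1 ⊗ v) = 1 ⊗ v for all v ∈ V, and λ₂₃ ∘ Γ₁₃ ∘ T₁₂ = Γ ∘ λ₂₃, μ₁₂ ∘ Γ₁₃ ∘ Γ₂₃ = Γ ∘ μ₁₂, and T₁₂ ∘ Γ₂₃ = Γ₂₃ ∘ T₁₂ as maps D ⊗ D ⊗ V → D ⊗ V (respectively D ⊗ D ⊗ V → D ⊗ D ⊗ V), where T₁₂ = T ⊗ id_V, Γ₂₃ = id_D ⊗ Γ,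 Γ₁₃ acts as Γ on the first and third tensor factors, λ₂₃ = id_D ⊗ λ, and μ₁₂ = μ ⊗ id_V. Then λ ∘ Γ is a left D^T-module structure on V: (λ ∘ Γ)(1 ⊗ v) = v and (λ ∘ Γ) ∘ ((μ ∘ T) ⊗ id_V) = (λ ∘ Γ) ∘ (id_D ⊗ (λ ∘ Γ)). -/
open TensorProduct

noncomputable section

/-- `Γ₂₃ = id_D ⊗ Γ` on `(D ⊗ D) ⊗ V`, for `Γ : D ⊗ V → D ⊗ V`. -/
def gam23 (k : Type*) [Field k] (D : Type*) [AddCommGroup D] [Module k D]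
    (V : Type*) [AddCommGroup V] [Module k V] (Γ : D ⊗[k] V →ₗ[k] D ⊗[k] V) :
    (D ⊗[k] D) ⊗[k] V →ₗ[k] (D ⊗[k] D) ⊗[k] V :=
  (TensorProduct.assoc k D D V).symm.toLinearMap ∘ₗ Γ.lTensor D ∘ₗ
    (TensorProduct.assoc k D D V).toLinearMap

/-- the canonical isomorphism `(D ⊗ D) ⊗ V ≅ (D ⊗ V) ⊗ D` flipping the last two factors. -/
def flipDV (k : Type*) [Field k] (D : Type*) [AddCommGroup D] [Module k D]
    (V : Type*) [AddCommGroup V] [Module k V] :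
    (D ⊗[k] D) ⊗[k] V ≃ₗ[k] (D ⊗[k] V) ⊗[k] D :=
  (TensorProduct.assoc k D D V) ≪≫ₗ
    (TensorProduct.congr (LinearEquiv.refl k D) (TensorProduct.comm k D V)) ≪≫ₗ
    (TensorProduct.assoc k D V D).symm

/-- `Γ₁₃` on `(D ⊗ D) ⊗ V`, acting as `Γ` on the first and third factors. -/
def gam13 (k : Type*) [Field k] (D : Type*) [AddCommGroup D] [Module k D]
    (V : Type*) [AddCommGroup V] [Module k V] (Γ : D ⊗[k] V →ₗ[k] D ⊗[k] V) :
    (D ⊗[k] D) ⊗[k] V →ₗ[k] (D ⊗[k] D) ⊗[k] V :=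
  (flipDV k D V).symm.toLinearMap ∘ₗ Γ.rTensor D ∘ₗ (flipDV k D V).toLinearMap

/-- `λ₂₃ = id_D ⊗ λ` on `(D ⊗ D) ⊗ V`. -/
def lam23 (k : Type*) [Field k] (D : Type*) [AddCommGroup D] [Module k D]
    (V : Type*) [AddCommGroup V] [Module k V] (lam : D ⊗[k] V →ₗ[k] V) :
    (D ⊗[k] D) ⊗[k] V →ₗ[k] D ⊗[k] V :=
  lam.lTensor D ∘ₗ (TensorProduct.assoc k D D V).toLinearMap

/-- `μ₁₂ = μ ⊗ id_V` on `(D ⊗ D) ⊗ V`. -/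
def mul12V (k : Type*) [Field k] (D : Type*) [AddCommGroup D] [Module k D]
    (V : Type*) [AddCommGroup V] [Module k V] (m : D ⊗[k] D →ₗ[k] D) :
    (D ⊗[k] D) ⊗[k] V →ₗ[k] D ⊗[k] V :=
  m.rTensor V

/-- Proposition 5.5 (i): lifting a left `D`-module structure `λ` on `V` along a left module
twistor `Γ` relative to a twistor `T` yields a left `D^T`-module structure `λ ∘ Γ` on `V`. -/
theorem left_module_twistor (k : Type*) [Field k] (D : Type*) [Ring D] [Algebra k D]
    (V : Type*) [AddCommGroup V] [Module k V]
    (T : D ⊗[k] D →ₗ[k] D ⊗[k] D) (hT : IsTwistor k D (LinearMap.mul' k D) 1 T)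
    (lam : D ⊗[k] V →ₗ[k] V)
    (hlam_one : ∀ v : V, lam ((1 : D) ⊗ₜ[k] v) = v)
    (hlam_mul : lam ∘ₗ (LinearMap.mul' k D).rTensor V =
      (lam ∘ₗ lam.lTensor D) ∘ₗ (TensorProduct.assoc k D D V).toLinearMap)
    (Γ : D ⊗[k] V →ₗ[k] D ⊗[k] V)
    (hΓ_one : ∀ v : V, Γ ((1 : D) ⊗ₜ[k] v) = (1 : D) ⊗ₜ[k] v)
    (hm1 : lam23 k D V lam ∘ₗ gam13 k D V Γ ∘ₗ T.rTensor V = Γ ∘ₗ lam23 k D V lam)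
    (hm2 : mul12V k D V (LinearMap.mul' k D) ∘ₗ gam13 k D V Γ ∘ₗ gam23 k D V Γ =
      Γ ∘ₗ mul12V k D V (LinearMap.mul' k D))
    (hm3 : T.rTensor V ∘ₗ gam23 k D V Γ = gam23 k D V Γ ∘ₗ T.rTensor V) :
    (∀ v : V, (lam ∘ₗ Γ) ((1 : D) ⊗ₜ[k] v) = v) ∧
    (lam ∘ₗ Γ) ∘ₗ (LinearMap.mul' k D ∘ₗ T).rTensor V =
      ((lam ∘ₗ Γ) ∘ₗ (lam ∘ₗ Γ).lTensor D) ∘ₗ (TensorProduct.assoc k D D V).toLinearMap := by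
  refine ⟨fun v => by simp [hΓ_one, hlam_one], ?_⟩
  refine LinearMap.ext fun x => ?_
  have e1 := fun y => LinearMap.congr_fun hm1 y
  have e2 := fun y => LinearMap.congr_fun hm2 y
  have e3 := fun y => LinearMap.congr_fun hm3 y
  have e4 := fun y => LinearMap.congr_fun hlam_mul y
  have h1 := e2 (T.rTensor V x)
  have h2 := e1 (gam23 k D V Γ x)
  have h3 := e3 x
  simp only [LinearMap.comp_apply] at h1 h2 h3 e4
  rw [h3] at h2
  have h4 := e4 (gam13 k D V Γ (gam23 k D V Γ (T.rTensor V x)))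
  have h5 : lam23 k D V lam (gam23 k D V Γ x) =
      (lam ∘ₗ Γ).lTensor D (TensorProduct.assoc k D D V x) := by
    simp [lam23, gam23, LinearMap.lTensor_comp]
  rw [h5] at h2
  simp only [LinearMap.comp_apply, LinearMap.rTensor_comp]
  refine (congrArg lam h1).symm.trans (h4.trans (congrArg lam h2))
end
end

section
/- Let D be an associative unital algebra over a field k with multiplication μ, T a twistor for D, and V a D-bimodule with left action λ : D ⊗ V → V and right action ρ : V ⊗ D → V (so λ and ρ are unital module actions satisfying λ ∘ (id_D ⊗ ρ) = ρ ∘ (λ ⊗ id_D)). Let Γ : D ⊗ V → D ⊗ V be a left module twistor for V relative to T and Π : V ⊗ D → V ⊗ D a right module twistor for V relative to T. Assume moreover that ρ₂₃ ∘ T₁₃ ∘ Γ₁₂ = Γ ∘ ρ₂₃ and λ₁₂ ∘ T₁₃ ∘ Π₂₃ = Π ∘ λ₁₂ and Γ₁₂ ∘ Π₂₃ = Π₂₃ ∘ Γ₁₂ as maps on D ⊗ V ⊗ D, where Γ₁₂ = Γ ⊗ id_D, Π₂₃ = id_D ⊗ Π, T₁₃ acts as T on the first and third tensor factors, ρ₂₃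 = id_D ⊗ ρ, λ₁₂ = λ ⊗ id_D. Then V with left action λ ∘ Γ and right action ρ ∘ Π is a D^T-bimodule; in particular (λ ∘ Γ) ∘ (id_D ⊗ (ρ ∘ Π)) = (ρ ∘ Π) ∘ ((λ ∘ Γ) ⊗ id_D) as maps D ⊗ V ⊗ D → V. -/
open TensorProduct

noncomputable section

/-- `Π₁₂ = Π ⊗ id_D` on `(V ⊗ D) ⊗ D`. -/
def pi12 (k : Type*) [Field k] (D : Type*) [AddCommGroup D] [Module k D]
    (V : Type*) [AddCommGroup V] [Module k V] (Pm : V ⊗[k] D →ₗ[k] V ⊗[k] D) :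
    (V ⊗[k] D) ⊗[k] D →ₗ[k] (V ⊗[k] D) ⊗[k] D :=
  Pm.rTensor D

/-- the flip of the last two factors on `(V ⊗ D) ⊗ D`. -/
def flipVDD (k : Type*) [Field k] (D : Type*) [AddCommGroup D] [Module k D]
    (V : Type*) [AddCommGroup V] [Module k V] :
    (V ⊗[k] D) ⊗[k] D →ₗ[k] (V ⊗[k] D) ⊗[k] D :=
  (TensorProduct.assoc k V D D).symm.toLinearMap ∘ₗ
    ((TensorProduct.comm k D D).toLinearMap.lTensor V) ∘ₗ
    (TensorProduct.assoc k V D D).toLinearMap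

/-- `Π₁₃` on `(V ⊗ D) ⊗ D`, acting as `Π` on the first and third factors. -/
def pi13 (k : Type*) [Field k] (D : Type*) [AddCommGroup D] [Module k D]
    (V : Type*) [AddCommGroup V] [Module k V] (Pm : V ⊗[k] D →ₗ[k] V ⊗[k] D) :
    (V ⊗[k] D) ⊗[k] D →ₗ[k] (V ⊗[k] D) ⊗[k] D :=
  flipVDD k D V ∘ₗ pi12 k D V Pm ∘ₗ flipVDD k D V

/-- `T₂₃ = id_V ⊗ T` on `(V ⊗ D) ⊗ D`. -/
def t23V (k : Type*) [Field k] (D : Type*) [AddCommGroup D] [Module k D]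
    (V : Type*) [AddCommGroup V] [Module k V] (T : D ⊗[k] D →ₗ[k] D ⊗[k] D) :
    (V ⊗[k] D) ⊗[k] D →ₗ[k] (V ⊗[k] D) ⊗[k] D :=
  (TensorProduct.assoc k V D D).symm.toLinearMap ∘ₗ T.lTensor V ∘ₗ
    (TensorProduct.assoc k V D D).toLinearMap

/-- `μ₂₃ = id_V ⊗ μ` on `(V ⊗ D) ⊗ D`. -/
def mul23V (k : Type*) [Field k] (D : Type*) [AddCommGroup D] [Module k D]
    (V : Type*) [AddCommGroup V] [Module k V] (m : D ⊗[k] D →ₗ[k] D) :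
    (V ⊗[k] D) ⊗[k] D →ₗ[k] V ⊗[k] D :=
  m.lTensor V ∘ₗ (TensorProduct.assoc k V D D).toLinearMap

/-- `ρ₁₂ = ρ ⊗ id_D` on `(V ⊗ D) ⊗ D`. -/
def rho12 (k : Type*) [Field k] (D : Type*) [AddCommGroup D] [Module k D]
    (V : Type*) [AddCommGroup V] [Module k V] (rho : V ⊗[k] D →ₗ[k] V) :
    (V ⊗[k] D) ⊗[k] D →ₗ[k] V ⊗[k] D :=
  rho.rTensor D

/-- the canonical isomorphism `(D ⊗ V) ⊗ D ≅ (D ⊗ D) ⊗ V` flipping the last two factors. -/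
def flipMid (k : Type*) [Field k] (D : Type*) [AddCommGroup D] [Module k D]
    (V : Type*) [AddCommGroup V] [Module k V] :
    (D ⊗[k] V) ⊗[k] D ≃ₗ[k] (D ⊗[k] D) ⊗[k] V :=
  (TensorProduct.assoc k D V D) ≪≫ₗ
    (TensorProduct.congr (LinearEquiv.refl k D) (TensorProduct.comm k V D)) ≪≫ₗ
    (TensorProduct.assoc k D D V).symm

/-- `T₁₃` on `(D ⊗ V) ⊗ D`, acting as `T` on the first and third factors. -/
def t13Mid (k : Type*) [Field k] (D : Type*) [AddCommGroup D] [Module k D]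
    (V : Type*) [AddCommGroup V] [Module k V] (T : D ⊗[k] D →ₗ[k] D ⊗[k] D) :
    (D ⊗[k] V) ⊗[k] D →ₗ[k] (D ⊗[k] V) ⊗[k] D :=
  (flipMid k D V).symm.toLinearMap ∘ₗ T.rTensor V ∘ₗ (flipMid k D V).toLinearMap

/-- `Γ₁₂ = Γ ⊗ id_D` on `(D ⊗ V) ⊗ D`. -/
def gam12Mid (k : Type*) [Field k] (D : Type*) [AddCommGroup D] [Module k D]
    (V : Type*) [AddCommGroup V] [Module k V] (Γ : D ⊗[k] V →ₗ[k] D ⊗[k] V) :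
    (D ⊗[k] V) ⊗[k] D →ₗ[k] (D ⊗[k] V) ⊗[k] D :=
  Γ.rTensor D

/-- `Π₂₃ = id_D ⊗ Π` on `(D ⊗ V) ⊗ D`. -/
def pi23Mid (k : Type*) [Field k] (D : Type*) [AddCommGroup D] [Module k D]
    (V : Type*) [AddCommGroup V] [Module k V] (Pm : V ⊗[k] D →ₗ[k] V ⊗[k] D) :
    (D ⊗[k] V) ⊗[k] D →ₗ[k] (D ⊗[k] V) ⊗[k] D :=
  (TensorProduct.assoc k D V D).symm.toLinearMap ∘ₗ Pm.lTensor D ∘ₗ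
    (TensorProduct.assoc k D V D).toLinearMap

/-- `ρ₂₃ = id_D ⊗ ρ` on `(D ⊗ V) ⊗ D`. -/
def rho23Mid (k : Type*) [Field k] (D : Type*) [AddCommGroup D] [Module k D]
    (V : Type*) [AddCommGroup V] [Module k V] (rho : V ⊗[k] D →ₗ[k] V) :
    (D ⊗[k] V) ⊗[k] D →ₗ[k] D ⊗[k] V :=
  rho.lTensor D ∘ₗ (TensorProduct.assoc k D V D).toLinearMap

/-- `λ₁₂ = λ ⊗ id_D` on `(D ⊗ V) ⊗ D`. -/
def lam12Mid (k : Type*) [Field k] (D : Type*) [AddCommGroup D] [Module k D]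
    (V : Type*) [AddCommGroup V] [Module k V] (lam : D ⊗[k] V →ₗ[k] V) :
    (D ⊗[k] V) ⊗[k] D →ₗ[k] V ⊗[k] D :=
  lam.rTensor D

/-- Proposition 5.5 (iii): given a `D`-bimodule `V`, a left module twistor `Γ` and a right
module twistor `Π` relative to a twistor `T`, satisfying the three compatibility conditions,
the deformed actions `λ ∘ Γ` and `ρ ∘ Π` make `V` a `D^T`-bimodule. -/
theorem bimodule_twistor (k : Type*) [Field k] (D : Type*) [Ring D] [Algebra k D]
    (V : Type*) [AddCommGroup V] [Module k V]
    (T : D ⊗[k] D →ₗ[k] D ⊗[k] D) (hT : IsTwistor k D (LinearMap.mul' k D) 1 T)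
    (lam : D ⊗[k] V →ₗ[k] V) (rho : V ⊗[k] D →ₗ[k] V)
    (hlam_one : ∀ v : V, lam ((1 : D) ⊗ₜ[k] v) = v)
    (hlam_mul : lam ∘ₗ (LinearMap.mul' k D).rTensor V =
      (lam ∘ₗ lam.lTensor D) ∘ₗ (TensorProduct.assoc k D D V).toLinearMap)
    (hrho_one : ∀ v : V, rho (v ⊗ₜ[k] (1 : D)) = v)
    (hrho_mul : rho ∘ₗ rho.rTensor D =
      rho ∘ₗ (LinearMap.mul' k D).lTensor V ∘ₗ (TensorProduct.assoc k V D D).toLinearMap)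
    (hbimod : lam ∘ₗ rho.lTensor D ∘ₗ (TensorProduct.assoc k D V D).toLinearMap =
      rho ∘ₗ lam.rTensor D)
    (Γ : D ⊗[k] V →ₗ[k] D ⊗[k] V) (Pm : V ⊗[k] D →ₗ[k] V ⊗[k] D)
    (hΓ_one : ∀ v : V, Γ ((1 : D) ⊗ₜ[k] v) = (1 : D) ⊗ₜ[k] v)
    (hm1 : lam23 k D V lam ∘ₗ gam13 k D V Γ ∘ₗ T.rTensor V = Γ ∘ₗ lam23 k D V lam)
    (hm2 : mul12V k D V (LinearMap.mul' k D) ∘ₗ gam13 k D V Γ ∘ₗ gam23 k D V Γ =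
      Γ ∘ₗ mul12V k D V (LinearMap.mul' k D))
    (hm3 : T.rTensor V ∘ₗ gam23 k D V Γ = gam23 k D V Γ ∘ₗ T.rTensor V)
    (hPm_one : ∀ v : V, Pm (v ⊗ₜ[k] (1 : D)) = v ⊗ₜ[k] (1 : D))
    (hn1 : mul23V k D V (LinearMap.mul' k D) ∘ₗ pi13 k D V Pm ∘ₗ pi12 k D V Pm =
      Pm ∘ₗ mul23V k D V (LinearMap.mul' k D))
    (hn2 : rho12 k D V rho ∘ₗ pi13 k D V Pm ∘ₗ t23V k D V T = Pm ∘ₗ rho12 k D V rho)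
    (hn3 : pi12 k D V Pm ∘ₗ t23V k D V T = t23V k D V T ∘ₗ pi12 k D V Pm)
    (hbim1 : rho23Mid k D V rho ∘ₗ t13Mid k D V T ∘ₗ gam12Mid k D V Γ =
      Γ ∘ₗ rho23Mid k D V rho)
    (hbim2 : lam12Mid k D V lam ∘ₗ t13Mid k D V T ∘ₗ pi23Mid k D V Pm =
      Pm ∘ₗ lam12Mid k D V lam)
    (hbim3 : gam12Mid k D V Γ ∘ₗ pi23Mid k D V Pm = pi23Mid k D V Pm ∘ₗ gam12Mid k D V Γ) :
    (∀ v : V, (lam ∘ₗ Γ) ((1 : D) ⊗ₜ[k] v) = v) ∧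
    ((lam ∘ₗ Γ) ∘ₗ (LinearMap.mul' k D ∘ₗ T).rTensor V =
      ((lam ∘ₗ Γ) ∘ₗ (lam ∘ₗ Γ).lTensor D) ∘ₗ (TensorProduct.assoc k D D V).toLinearMap) ∧
    (∀ v : V, (rho ∘ₗ Pm) (v ⊗ₜ[k] (1 : D)) = v) ∧
    ((rho ∘ₗ Pm) ∘ₗ (rho ∘ₗ Pm).rTensor D =
      (rho ∘ₗ Pm) ∘ₗ (LinearMap.mul' k D ∘ₗ T).lTensor V ∘ₗ
        (TensorProduct.assoc k V D D).toLinearMap) ∧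
    ((lam ∘ₗ Γ) ∘ₗ (rho ∘ₗ Pm).lTensor D ∘ₗ (TensorProduct.assoc k D V D).toLinearMap =
      (rho ∘ₗ Pm) ∘ₗ (lam ∘ₗ Γ).rTensor D) := by
  refine ⟨fun v => by simp [hΓ_one, hlam_one], ?_, fun v => by simp [hPm_one, hrho_one], ?_, ?_⟩
  · have e1 : (lam ∘ₗ Γ).lTensor D ∘ₗ (TensorProduct.assoc k D D V).toLinearMap =
        lam23 k D V lam ∘ₗ gam23 k D V Γ := by
      ext x; simp [lam23, gam23]
    have e2 : (LinearMap.mul' k D ∘ₗ T).rTensor V =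
        mul12V k D V (LinearMap.mul' k D) ∘ₗ T.rTensor V := by
      rw [LinearMap.rTensor_comp]; rfl
    have e3 : lam ∘ₗ mul12V k D V (LinearMap.mul' k D) = lam ∘ₗ lam23 k D V lam := hlam_mul
    calc _ = lam ∘ₗ (Γ ∘ₗ mul12V k D V (LinearMap.mul' k D)) ∘ₗ T.rTensor V := by
          rw [e2]; rfl
      _ = (lam ∘ₗ mul12V k D V (LinearMap.mul' k D)) ∘ₗ gam13 k D V Γ ∘ₗ
            (gam23 k D V Γ ∘ₗ T.rTensor V) := by rw [← hm2]; rfl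
      _ = lam ∘ₗ (lam23 k D V lam ∘ₗ gam13 k D V Γ ∘ₗ T.rTensor V) ∘ₗ gam23 k D V Γ := by
          rw [e3, ← hm3]; rfl
      _ = lam ∘ₗ Γ ∘ₗ (lam23 k D V lam ∘ₗ gam23 k D V Γ) := by rw [hm1]; rfl
      _ = _ := by rw [← e1]; rfl
  · have e1 : (LinearMap.mul' k D ∘ₗ T).lTensor V ∘ₗ (TensorProduct.assoc k V D D).toLinearMap =
        mul23V k D V (LinearMap.mul' k D) ∘ₗ t23V k D V T := by
      ext x; simp [mul23V, t23V]
    have e2 : (rho ∘ₗ Pm).rTensor D = rho12 k D V rho ∘ₗ pi12 k D V Pm := by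
      rw [LinearMap.rTensor_comp]; rfl
    have e3 : rho ∘ₗ rho12 k D V rho = rho ∘ₗ mul23V k D V (LinearMap.mul' k D) := hrho_mul
    calc _ = rho ∘ₗ (Pm ∘ₗ rho12 k D V rho) ∘ₗ pi12 k D V Pm := by rw [e2]; rfl
      _ = (rho ∘ₗ rho12 k D V rho) ∘ₗ pi13 k D V Pm ∘ₗ (t23V k D V T ∘ₗ pi12 k D V Pm) := by
          rw [← hn2]; rfl
      _ = rho ∘ₗ (mul23V k D V (LinearMap.mul' k D) ∘ₗ pi13 k D V Pm ∘ₗ pi12 k D V Pm) ∘ₗ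
            t23V k D V T := by rw [e3, ← hn3]; rfl
      _ = (rho ∘ₗ Pm) ∘ₗ (mul23V k D V (LinearMap.mul' k D) ∘ₗ t23V k D V T) := by
          rw [hn1]; rfl
      _ = _ := by rw [← e1]
  · have e1 : (rho ∘ₗ Pm).lTensor D ∘ₗ (TensorProduct.assoc k D V D).toLinearMap =
        rho23Mid k D V rho ∘ₗ pi23Mid k D V Pm := by
      ext x; simp [rho23Mid, pi23Mid]
    have e2 : (lam ∘ₗ Γ).rTensor D = lam12Mid k D V lam ∘ₗ gam12Mid k D V Γ := by
      rw [LinearMap.rTensor_comp]; rfl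
    have e3 : lam ∘ₗ rho23Mid k D V rho = rho ∘ₗ lam12Mid k D V lam := hbimod
    calc _ = lam ∘ₗ (Γ ∘ₗ rho23Mid k D V rho) ∘ₗ pi23Mid k D V Pm := by rw [e1]; rfl
      _ = (lam ∘ₗ rho23Mid k D V rho) ∘ₗ t13Mid k D V T ∘ₗ
            (gam12Mid k D V Γ ∘ₗ pi23Mid k D V Pm) := by rw [← hbim1]; rfl
      _ = rho ∘ₗ (lam12Mid k D V lam ∘ₗ t13Mid k D V T ∘ₗ pi23Mid k D V Pm) ∘ₗ
            gam12Mid k D V Γ := by rw [e3, hbim3]; rfl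
      _ = (rho ∘ₗ Pm) ∘ₗ (lam12Mid k D V lam ∘ₗ gam12Mid k D V Γ) := by rw [hbim2]; rfl
      _ = _ := by rw [← e2]
end
end
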